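/- arXiv:1501.00539 — 5 statements merged into one kernel-verified Lean document; each statement's English description precedes it below -/
import Mathlib

section
/- Let f₁, …, f_p be probability density functions on ℝⁿ, let q₁, …, q_p ≥ 0 sum to one, and let f = Σ_{ℓ=1}^p q_ℓ f_ℓ be the mixture density. Then for every α > 0 with α ≠ 1, the order-α Rényi entropy of the mixture satisfies h_α(f) ≥ min_{1 ≤ ℓ ≤ p} h_α(f_ℓ). -/
open MeasureTheory ENNReal Filter

noncomputable section

/-- `f` is a probability density (w.r.t. Lebesgue measure) on `ℝⁿ`. -/
def IsDensity {n : ℕ} (f : (Fin n → ℝ) → ℝ) : Prop :=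
  Measurable f ∧ (∀ x, 0 ≤ f x) ∧ ∫⁻ x, ENNReal.ofReal (f x) = 1

/-- `∫ f(x)^α dx`, as an extended nonnegative real. -/
def renyiIntegral {n : ℕ} (f : (Fin n → ℝ) → ℝ) (α : ℝ) : ℝ≥0∞ :=
  ∫⁻ x, ENNReal.ofReal (f x ^ α)

/-- Order-`α` Rényi entropy of a density on `ℝⁿ`: `(1/(1-α)) log ∫ f^α`, interpreted as `+∞`
if the integral diverges and `α < 1`, and as `-∞` if it diverges and `α > 1`. -/
def renyiEntropy {n : ℕ} (f : (Fin n → ℝ) → ℝ) (α : ℝ) : EReal :=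
  if renyiIntegral f α = ∞ then (if α < 1 then (⊤ : EReal) else (⊥ : EReal))
  else (((1 - α)⁻¹ * Real.log (renyiIntegral f α).toReal : ℝ) : EReal)

/-- A probability density has a nonzero `α`-integral for `α > 0`. -/
lemma IsDensity.renyiIntegral_ne_zero {n : ℕ} {f : (Fin n → ℝ) → ℝ} (hf : IsDensity f)
    {α : ℝ} (hα : 0 < α) : renyiIntegral f α ≠ 0 := by
  obtain ⟨hm, h0, h1⟩ := hf
  intro h
  have hae := (lintegral_eq_zero_iff (hm.pow_const α).ennreal_ofReal).1 h
  have : ∫⁻ x, ENNReal.ofReal (f x) = 0 := by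
    rw [lintegral_eq_zero_iff hm.ennreal_ofReal]
    filter_upwards [hae] with x hx
    have hle : f x ^ α ≤ 0 := ENNReal.ofReal_eq_zero.1 hx
    have heq : f x = 0 :=
      (Real.rpow_eq_zero (h0 x) hα.ne').1 (le_antisymm hle (Real.rpow_nonneg (h0 x) α))
    simp [heq]
  simp [h1] at this

/-- The integral of a finite nonnegative combination, as an extended nonnegative real. -/
lemma lintegral_ofReal_sum_mul {n : ℕ} {ι : Type*} [Fintype ι] {g : ι → (Fin n → ℝ) → ℝ}
    {q : ι → ℝ} (hg : ∀ ℓ, Measurable (g ℓ)) (hg0 : ∀ ℓ x, 0 ≤ g ℓ x) (hq : ∀ ℓ, 0 ≤ q ℓ) :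
    ∫⁻ x, ENNReal.ofReal (∑ ℓ, q ℓ * g ℓ x) =
      ∑ ℓ, ENNReal.ofReal (q ℓ) * ∫⁻ x, ENNReal.ofReal (g ℓ x) := by
  have hpt : ∀ x, ENNReal.ofReal (∑ ℓ, q ℓ * g ℓ x) =
      ∑ ℓ, ENNReal.ofReal (q ℓ) * ENNReal.ofReal (g ℓ x) := fun x => by
    rw [ENNReal.ofReal_sum_of_nonneg fun ℓ _ => mul_nonneg (hq ℓ) (hg0 ℓ x)]
    exact Finset.sum_congr rfl fun ℓ _ => ENNReal.ofReal_mul (hq ℓ)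
  simp_rw [hpt]
  rw [lintegral_finsetSum _ fun ℓ _ => (hg ℓ).ennreal_ofReal.const_mul _]
  exact Finset.sum_congr rfl fun ℓ _ => lintegral_const_mul _ (hg ℓ).ennreal_ofReal

lemma sum_ofReal_eq_one {ι : Type*} [Fintype ι] {q : ι → ℝ} (hq : ∀ ℓ, 0 ≤ q ℓ)
    (hqsum : ∑ ℓ, q ℓ = 1) : ∑ ℓ, ENNReal.ofReal (q ℓ) = 1 := by
  rw [← ENNReal.ofReal_sum_of_nonneg fun ℓ _ => hq ℓ, hqsum, ENNReal.ofReal_one]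

/-- A mixture of probability densities is a probability density. -/
lemma IsDensity.mixture {n : ℕ} {ι : Type*} [Fintype ι] {f : ι → (Fin n → ℝ) → ℝ} {q : ι → ℝ}
    (hf : ∀ ℓ, IsDensity (f ℓ)) (hq : ∀ ℓ, 0 ≤ q ℓ) (hqsum : ∑ ℓ, q ℓ = 1) :
    IsDensity fun x => ∑ ℓ, q ℓ * f ℓ x := by
  refine ⟨Finset.measurable_fun_sum _ fun ℓ _ => (hf ℓ).1.const_mul _,
    fun x => Finset.sum_nonneg fun ℓ _ => mul_nonneg (hq ℓ) ((hf ℓ).2.1 x), ?_⟩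
  rw [lintegral_ofReal_sum_mul (fun ℓ => (hf ℓ).1) (fun ℓ => (hf ℓ).2.1) hq]
  simp [(hf _).2.2, sum_ofReal_eq_one hq hqsum]

/-- A weighted mean is at least one of the values. -/
lemma exists_le_weighted_mean {ι : Type*} [Fintype ι] [Nonempty ι] {w : ι → ℝ≥0∞}
    (hw : ∑ ℓ, w ℓ = 1) (I : ι → ℝ≥0∞) : ∃ ℓ, I ℓ ≤ ∑ k, w k * I k := by
  obtain ⟨ℓ, hℓ⟩ := Finite.exists_min I
  refine ⟨ℓ, ?_⟩
  calc I ℓ = ∑ k, w k * I ℓ := by rw [← Finset.sum_mul, hw, one_mul]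
    _ ≤ ∑ k, w k * I k := Finset.sum_le_sum fun k _ => mul_le_mul_right (hℓ k) _

/-- A weighted mean is at most one of the values. -/
lemma exists_weighted_mean_le {ι : Type*} [Fintype ι] [Nonempty ι] {w : ι → ℝ≥0∞}
    (hw : ∑ ℓ, w ℓ = 1) (I : ι → ℝ≥0∞) : ∃ ℓ, ∑ k, w k * I k ≤ I ℓ := by
  obtain ⟨ℓ, hℓ⟩ := Finite.exists_max I
  refine ⟨ℓ, ?_⟩
  calc ∑ k, w k * I k ≤ ∑ k, w k * I ℓ := Finset.sum_le_sum fun k _ => mul_le_mul_right (hℓ k) _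
    _ = I ℓ := by rw [← Finset.sum_mul, hw, one_mul]

/-- For `0 < α < 1`, the Rényi entropy is increasing in the `α`-integral. -/
lemma renyiEntropy_le_of_lt_one {n : ℕ} {f g : (Fin n → ℝ) → ℝ} {α : ℝ} (hα1 : α < 1)
    (hf : renyiIntegral f α ≠ 0) (h : renyiIntegral f α ≤ renyiIntegral g α) :
    renyiEntropy f α ≤ renyiEntropy g α := by
  unfold renyiEntropy
  by_cases hg : renyiIntegral g α = ∞
  · simp [hg, hα1]
  have hf' : renyiIntegral f α ≠ ∞ := ne_top_of_le_ne_top hg h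
  rw [if_neg hg, if_neg hf', EReal.coe_le_coe_iff]
  exact mul_le_mul_of_nonneg_left
    (Real.log_le_log (ENNReal.toReal_pos hf hf') (ENNReal.toReal_mono hg h))
    (inv_nonneg.2 (sub_nonneg.2 hα1.le))

/-- For `α > 1`, the Rényi entropy is decreasing in the `α`-integral. -/
lemma renyiEntropy_le_of_one_lt {n : ℕ} {f g : (Fin n → ℝ) → ℝ} {α : ℝ} (hα1 : 1 < α)
    (hg : renyiIntegral g α ≠ 0) (h : renyiIntegral g α ≤ renyiIntegral f α) :
    renyiEntropy f α ≤ renyiEntropy g α := by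
  unfold renyiEntropy
  by_cases hf : renyiIntegral f α = ∞
  · simp [hf, hα1.not_gt]
  have hg' : renyiIntegral g α ≠ ∞ := ne_top_of_le_ne_top hf h
  rw [if_neg hg', if_neg hf, EReal.coe_le_coe_iff]
  exact mul_le_mul_of_nonpos_left
    (Real.log_le_log (ENNReal.toReal_pos hg hg') (ENNReal.toReal_mono hf h))
    (inv_nonpos.2 (sub_nonpos.2 hα1.le))

/-- Lemma on mixtures, lower bound: if `f₁, …, f_p` are densities on `ℝⁿ`
and `q₁, …, q_p ≥ 0` sum to one, then for every `α > 0`, `α ≠ 1`, the Rényi entropy of the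
mixture `∑ ℓ, q ℓ • f ℓ` is at least the minimum of the Rényi entropies of the components. -/
theorem renyi_mixture_lower_bound
    (n p : ℕ) (f : Fin p → (Fin n → ℝ) → ℝ) (q : Fin p → ℝ)
    (hf : ∀ ℓ, IsDensity (f ℓ)) (hq : ∀ ℓ, 0 ≤ q ℓ) (hqsum : ∑ ℓ, q ℓ = 1)
    (α : ℝ) (hα : 0 < α) (hα1 : α ≠ 1) :
    (⨅ ℓ, renyiEntropy (f ℓ) α) ≤ renyiEntropy (fun x => ∑ ℓ, q ℓ * f ℓ x) α := by
  have hne : Nonempty (Fin p) := by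
    by_contra hp
    rw [not_nonempty_iff] at hp
    simp at hqsum
  have hmean : ∫⁻ x, ENNReal.ofReal (∑ ℓ, q ℓ * f ℓ x ^ α) =
      ∑ ℓ, ENNReal.ofReal (q ℓ) * renyiIntegral (f ℓ) α :=
    lintegral_ofReal_sum_mul (fun ℓ => (hf ℓ).1.pow_const α)
      (fun ℓ x => Real.rpow_nonneg ((hf ℓ).2.1 x) α) hq
  have hw := sum_ofReal_eq_one hq hqsum
  rcases lt_or_gt_of_ne hα1 with hlt | hgt
  · obtain ⟨ℓ, hℓ⟩ := exists_le_weighted_mean hw fun ℓ => renyiIntegral (f ℓ) α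
    refine (iInf_le _ ℓ).trans (renyiEntropy_le_of_lt_one hlt
      ((hf ℓ).renyiIntegral_ne_zero hα) (hℓ.trans (hmean.ge.trans ?_)))
    refine lintegral_mono fun x => ENNReal.ofReal_le_ofReal ?_
    exact (Real.concaveOn_rpow hα.le hlt.le).le_map_sum (fun ℓ _ => hq ℓ) hqsum
      fun ℓ _ => (hf ℓ).2.1 x
  · obtain ⟨ℓ, hℓ⟩ := exists_weighted_mean_le hw fun ℓ => renyiIntegral (f ℓ) α
    refine (iInf_le _ ℓ).trans (renyiEntropy_le_of_one_lt hgt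
      ((IsDensity.mixture hf hq hqsum).renyiIntegral_ne_zero hα) (le_trans ?_ (hmean.le.trans hℓ)))
    refine lintegral_mono fun x => ENNReal.ofReal_le_ofReal ?_
    exact (convexOn_rpow hgt.le).map_sum_le (fun ℓ _ => hq ℓ) hqsum fun ℓ _ => (hf ℓ).2.1 x
end
end

section
/- Let S ⊆ ℝ be measurable, r : ℝ → ℝ measurable, and Γ ∈ ℝ. Let f be a probability density supported by S for which the differential Shannon entropy h(f) is defined, ∫ f(x)·|r(x)| dx < ∞, and ∫ f(x)·r(x) dx ≤ Γ. Then for every δ > 0 there exists a probability density f̃ that is bounded, supported by S, and satisfies ∫ f̃(x)·r(x) dx ≤ Γ + δ and h(f̃) ≥ h(f) − δ. -/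
open MeasureTheory ENNReal Filter

noncomputable section

/-- `f` is a probability density (w.r.t. Lebesgue measure) on `ℝ`. -/
def IsDensity1 (f : ℝ → ℝ) : Prop :=
  Measurable f ∧ (∀ x, 0 ≤ f x) ∧ ∫⁻ x, ENNReal.ofReal (f x) = 1

/-- `∫ (f log f)⁺`, the positive part of `∫ f log f`. -/
def shannonNegPart (f : ℝ → ℝ) : ℝ≥0∞ := ∫⁻ x, ENNReal.ofReal (f x * Real.log (f x))

/-- `∫ (f log f)⁻`, the negative part of `∫ f log f`. -/
def shannonPosPart (f : ℝ → ℝ) : ℝ≥0∞ := ∫⁻ x, ENNReal.ofReal (-(f x * Real.log (f x)))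

/-- The differential Shannon entropy `-∫ f log f` is defined (possibly `±∞`): the positive
and negative parts of the integral are not both infinite. -/
def ShannonDefined (f : ℝ → ℝ) : Prop := shannonPosPart f ≠ ∞ ∨ shannonNegPart f ≠ ∞

/-- Differential Shannon entropy `-∫ f log f`, as an extended real. -/
def shannonEntropy (f : ℝ → ℝ) : EReal :=
  (shannonPosPart f : EReal) - (shannonNegPart f : EReal)

open Topology

theorem integrable_of_lintegral_ofReal_ne_top {u : ℝ → ℝ} (hu : Measurable u)
    (hpos : (∫⁻ x, ENNReal.ofReal (u x)) ≠ ∞) (hneg : (∫⁻ x, ENNReal.ofReal (-u x)) ≠ ∞) :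
    Integrable u := by
  refine ⟨hu.aestronglyMeasurable, ?_⟩
  rw [hasFiniteIntegral_iff_norm]
  have h : ∀ x, ENNReal.ofReal ‖u x‖ ≤ ENNReal.ofReal (u x) + ENNReal.ofReal (-u x) := by
    intro x
    rw [Real.norm_eq_abs]
    rcases abs_cases (u x) with ⟨h, _⟩ | ⟨h, _⟩ <;> rw [h]
    · exact le_self_add
    · exact le_add_self
  refine (lintegral_mono h).trans_lt ?_
  rw [lintegral_add_left hu.ennreal_ofReal]
  exact ENNReal.add_lt_top.2 ⟨hpos.lt_top, hneg.lt_top⟩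

theorem IsDensity1.integrable {f : ℝ → ℝ} (hf : IsDensity1 f) : Integrable f := by
  refine integrable_of_lintegral_ofReal_ne_top hf.1 (by rw [hf.2.2]; simp) ?_
  have h : ∀ x, ENNReal.ofReal (-f x) = 0 := fun x =>
    ENNReal.ofReal_of_nonpos (neg_nonpos.2 (hf.2.1 x))
  simp [h]

theorem IsDensity1.integral_eq_one {f : ℝ → ℝ} (hf : IsDensity1 f) : ∫ x, f x = 1 := by
  rw [integral_eq_lintegral_of_nonneg_ae (ae_of_all _ hf.2.1) hf.1.aestronglyMeasurable, hf.2.2]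
  simp

theorem isDensity1_of_integral_eq_one {f : ℝ → ℝ} (hm : Measurable f) (h0 : ∀ x, 0 ≤ f x)
    (hi : Integrable f) (h1 : ∫ x, f x = 1) : IsDensity1 f := by
  refine ⟨hm, h0, ?_⟩
  rw [← ofReal_integral_eq_lintegral_ofReal hi (ae_of_all _ h0), h1]
  simp

theorem measurable_mul_log {f : ℝ → ℝ} (hf : Measurable f) :
    Measurable fun x => f x * Real.log (f x) :=
  hf.mul hf.log

theorem shannonEntropy_eq_neg_integral {f : ℝ → ℝ}
    (hi : Integrable fun x => f x * Real.log (f x)) :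
    shannonEntropy f = ((-∫ x, f x * Real.log (f x) : ℝ) : EReal) := by
  have hN : shannonNegPart f ≠ ∞ := hi.lintegral_lt_top.ne
  have hP : shannonPosPart f ≠ ∞ := hi.neg.lintegral_lt_top.ne
  rw [integral_eq_lintegral_pos_part_sub_lintegral_neg_part hi, neg_sub, EReal.coe_sub]
  change _ = ((shannonPosPart f).toReal : EReal) - ((shannonNegPart f).toReal : EReal)
  rw [EReal.coe_ennreal_toReal hP, EReal.coe_ennreal_toReal hN, shannonEntropy]

theorem IsDensity1.shannonNegPart_ne_top_of_bounded {f : ℝ → ℝ} (hf : IsDensity1 f) {M : ℝ}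
    (hM : ∀ x, f x ≤ M) : shannonNegPart f ≠ ∞ := by
  refine ne_top_of_le_ne_top (hf.integrable.const_mul M).lintegral_lt_top.ne
    (lintegral_mono fun x => ENNReal.ofReal_le_ofReal ?_)
  rw [mul_comm]
  exact mul_le_mul_of_nonneg_right ((Real.log_le_self (hf.2.1 x)).trans (hM x)) (hf.2.1 x)

theorem tendsto_integral_indicator_sublevel {f u : ℝ → ℝ} (hf : Measurable f) (hu : Integrable u) :
    Tendsto (fun n : ℕ => ∫ x, {y | f y ≤ n}.indicator u x) atTop (𝓝 (∫ x, u x)) := by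
  refine tendsto_integral_of_dominated_convergence (fun x => ‖u x‖)
    (fun n => (hu.indicator (measurableSet_le hf measurable_const)).aestronglyMeasurable)
    hu.norm (fun n => ae_of_all _ fun x => norm_indicator_le_norm_self _ _)
    (ae_of_all _ fun x => ?_)
  refine tendsto_const_nhds.congr' ?_
  filter_upwards [tendsto_natCast_atTop_atTop.eventually_ge_atTop (f x)] with n hn
  rw [Set.indicator_of_mem (show x ∈ {y | f y ≤ n} from hn)]

/-- The density `f` conditioned on the event that its value is at most `n`. -/
def truncatedDensity (f : ℝ → ℝ) (n : ℕ) (x : ℝ) : ℝ :=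
  (∫ y, {z | f z ≤ n}.indicator f y)⁻¹ * {z | f z ≤ n}.indicator f x

theorem truncatedDensity_mul (f u : ℝ → ℝ) (n : ℕ) (x : ℝ) :
    truncatedDensity f n x * u x = (∫ y, {z | f z ≤ n}.indicator f y)⁻¹ *
      {z | f z ≤ n}.indicator (fun y => f y * u y) x := by
  by_cases hx : x ∈ {z | f z ≤ n} <;> simp [truncatedDensity, hx, mul_assoc]

theorem truncatedDensity_mul_log {f : ℝ → ℝ} {n : ℕ}
    (hc : 0 < ∫ y, {z | f z ≤ n}.indicator f y) (x : ℝ) :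
    truncatedDensity f n x * Real.log (truncatedDensity f n x) =
      (∫ y, {z | f z ≤ n}.indicator f y)⁻¹ *
        {z | f z ≤ n}.indicator (fun y => f y * Real.log (f y)) x -
      Real.log (∫ y, {z | f z ≤ n}.indicator f y) * truncatedDensity f n x := by
  unfold truncatedDensity
  generalize (∫ y, {z | f z ≤ n}.indicator f y) = c at hc
  by_cases hx : x ∈ {z | f z ≤ n}
  · simp only [Set.indicator_of_mem hx]
    by_cases h0 : f x = 0
    · simp [h0]
    · rw [Real.log_mul (inv_ne_zero hc.ne') h0, Real.log_inv]
      ring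
  · simp [hx]

theorem isDensity1_truncatedDensity {f : ℝ → ℝ} (hf : IsDensity1 f) {n : ℕ}
    (hc : 0 < ∫ y, {z | f z ≤ n}.indicator f y) : IsDensity1 (truncatedDensity f n) := by
  have hA : MeasurableSet {z | f z ≤ n} := measurableSet_le hf.1 measurable_const
  refine isDensity1_of_integral_eq_one ((hf.1.indicator hA).const_mul _)
    (fun x => mul_nonneg (inv_nonneg.2 hc.le) (Set.indicator_nonneg (fun y _ => hf.2.1 y) x))
    ((hf.integrable.indicator hA).const_mul _) ?_
  simp only [truncatedDensity]
  rw [integral_const_mul, inv_mul_cancel₀ hc.ne']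

theorem truncatedDensity_le {f : ℝ → ℝ} {n : ℕ}
    (hc : 0 < ∫ y, {z | f z ≤ n}.indicator f y) (x : ℝ) :
    truncatedDensity f n x ≤ (∫ y, {z | f z ≤ n}.indicator f y)⁻¹ * n := by
  refine mul_le_mul_of_nonneg_left ?_ (inv_nonneg.2 hc.le)
  exact Set.indicator_le' (fun y hy => hy) (fun _ _ => Nat.cast_nonneg n) x

theorem integrable_truncatedDensity_mul {f u : ℝ → ℝ} (hf : Measurable f)
    (hu : Integrable fun x => f x * u x) (n : ℕ) :
    Integrable fun x => truncatedDensity f n x * u x := by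
  simp only [truncatedDensity_mul]
  exact (hu.indicator (measurableSet_le hf measurable_const)).const_mul _

theorem tendsto_integral_truncatedDensity_mul {f u : ℝ → ℝ} (hf : IsDensity1 f)
    (hu : Integrable fun x => f x * u x) :
    Tendsto (fun n => ∫ x, truncatedDensity f n x * u x) atTop (𝓝 (∫ x, f x * u x)) := by
  simp only [truncatedDensity_mul, integral_const_mul]
  have hc := tendsto_integral_indicator_sublevel hf.1 hf.integrable
  rw [hf.integral_eq_one] at hc
  simpa using (hc.inv₀ one_ne_zero).mul (tendsto_integral_indicator_sublevel hf.1 hu)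

theorem integral_truncatedDensity_mul_log {f : ℝ → ℝ} (hf : IsDensity1 f) {n : ℕ}
    (hc : 0 < ∫ y, {z | f z ≤ n}.indicator f y)
    (hi : Integrable fun x => f x * Real.log (f x)) :
    Integrable (fun x => truncatedDensity f n x * Real.log (truncatedDensity f n x)) ∧
    ∫ x, truncatedDensity f n x * Real.log (truncatedDensity f n x) =
      (∫ x, truncatedDensity f n x * Real.log (f x)) -
        Real.log (∫ y, {z | f z ≤ n}.indicator f y) := by
  have hd := isDensity1_truncatedDensity hf hc
  simp only [truncatedDensity_mul_log hc, ← truncatedDensity_mul f (fun x => Real.log (f x))]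
  have h1 := integrable_truncatedDensity_mul hf.1 hi n
  have h2 := hd.integrable.const_mul (Real.log (∫ y, {z | f z ≤ n}.indicator f y))
  refine ⟨h1.sub h2, ?_⟩
  rw [integral_sub h1 h2, integral_const_mul, hd.integral_eq_one, mul_one]

theorem shannonPosPart_truncatedDensity_eq_top {f : ℝ → ℝ} (hf : IsDensity1 f) {n : ℕ}
    (hc : 0 < ∫ y, {z | f z ≤ n}.indicator f y) (hn : 1 ≤ n) (hP : shannonPosPart f = ∞) :
    shannonPosPart (truncatedDensity f n) = ∞ := by
  by_contra hfin
  have hd := isDensity1_truncatedDensity hf hc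
  have hi := integrable_of_lintegral_ofReal_ne_top (measurable_mul_log hd.1)
    (hd.shannonNegPart_ne_top_of_bounded (truncatedDensity_le hc)) hfin
  have hj : Integrable ({z | f z ≤ n}.indicator fun y => f y * Real.log (f y)) := by
    refine ((hi.add (hd.integrable.const_mul
      (Real.log (∫ y, {z | f z ≤ n}.indicator f y)))).const_mul
      (∫ y, {z | f z ≤ n}.indicator f y)).congr (ae_of_all _ fun x => ?_)
    simp only [Pi.add_apply, truncatedDensity_mul_log hc, sub_add_cancel]
    exact mul_inv_cancel_left₀ hc.ne' _
  refine ne_top_of_le_ne_top hj.neg.lintegral_lt_top.ne (lintegral_mono fun x => ?_) hP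
  by_cases hx : x ∈ {z | f z ≤ n}
  · simp [hx]
  · have h1 : 1 ≤ f x := (Nat.one_le_cast.2 hn).trans (not_le.1 hx).le
    rw [ENNReal.ofReal_of_nonpos
      (neg_nonpos.2 (mul_nonneg (hf.2.1 x) (Real.log_nonneg h1)))]
    exact zero_le

theorem eventually_shannonEntropy_sub_le_truncatedDensity {f : ℝ → ℝ} (hf : IsDensity1 f)
    {δ : ℝ} (hδ : 0 < δ) :
    ∀ᶠ n in atTop, shannonEntropy f - (δ : EReal) ≤ shannonEntropy (truncatedDensity f n) := by
  have hc := tendsto_integral_indicator_sublevel hf.1 hf.integrable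
  rw [hf.integral_eq_one] at hc
  have hcpos := hc.eventually_const_lt one_pos
  by_cases hN : shannonNegPart f = ∞
  · have h : shannonEntropy f = ⊥ := by
      simp [shannonEntropy, hN]
    simp [h]
  by_cases hP : shannonPosPart f = ∞
  · filter_upwards [hcpos, eventually_ge_atTop 1] with n hn h1
    have hN' := (isDensity1_truncatedDensity hf hn).shannonNegPart_ne_top_of_bounded
      (truncatedDensity_le hn)
    rw [shannonEntropy.eq_def (truncatedDensity f n),
      shannonPosPart_truncatedDensity_eq_top hf hn h1 hP,
      ← EReal.coe_ennreal_toReal hN', EReal.coe_ennreal_top, EReal.top_sub_coe]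
    exact le_top
  · have hi := integrable_of_lintegral_ofReal_ne_top (measurable_mul_log hf.1) hN hP
    have hlim := (tendsto_integral_truncatedDensity_mul hf hi).sub
      (hc.log one_ne_zero)
    rw [Real.log_one, sub_zero] at hlim
    filter_upwards [hcpos, hlim.eventually_lt_const (lt_add_of_pos_right _ hδ)] with n hn hlt
    obtain ⟨hi', heq⟩ := integral_truncatedDensity_mul_log hf hn hi
    rw [shannonEntropy_eq_neg_integral hi, shannonEntropy_eq_neg_integral hi', ← EReal.coe_sub,
      EReal.coe_le_coe_iff, heq]
    linarith

/-- Lemma 3: let `f` be a density supported by `S` with `h(f)` defined,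
`∫ f·|r| < ∞` and `∫ f·r ≤ Γ`. Then for every `δ > 0` there is a bounded density `f̃`
supported by `S` with `∫ f̃·r ≤ Γ + δ` (the integral being well defined) and
`h(f̃) ≥ h(f) - δ`. -/
theorem bounded_density_approximation
    (S : Set ℝ) (hS : MeasurableSet S) (r : ℝ → ℝ) (hr : Measurable r) (Γ : ℝ)
    (f : ℝ → ℝ) (hf : IsDensity1 f) (hsupp : ∀ x ∉ S, f x = 0)
    (hdef : ShannonDefined f)
    (hint : (∫⁻ x, ENNReal.ofReal (f x * |r x|)) ≠ ∞)
    (hcost : ∫ x, f x * r x ≤ Γ)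
    (δ : ℝ) (hδ : 0 < δ) :
    ∃ ftilde : ℝ → ℝ, IsDensity1 ftilde ∧ (∃ M : ℝ, ∀ x, ftilde x ≤ M) ∧
      (∀ x ∉ S, ftilde x = 0) ∧
      (∫⁻ x, ENNReal.ofReal (ftilde x * |r x|)) ≠ ∞ ∧
      (∫ x, ftilde x * r x) ≤ Γ + δ ∧
      ShannonDefined ftilde ∧
      shannonEntropy f - (δ : EReal) ≤ shannonEntropy ftilde := by
  have hfr : Integrable fun x => f x * r x := by
    refine ⟨(hf.1.mul hr).aestronglyMeasurable, ?_⟩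
    rw [hasFiniteIntegral_iff_norm]
    simpa [abs_mul, abs_of_nonneg (hf.2.1 _)] using hint.lt_top
  have hc := tendsto_integral_indicator_sublevel hf.1 hf.integrable
  rw [hf.integral_eq_one] at hc
  obtain ⟨n, hn, hcost', hent⟩ := ((hc.eventually_const_lt one_pos).and
    (((tendsto_integral_truncatedDensity_mul hf hfr).eventually_lt_const
      (lt_add_of_pos_right _ hδ)).and
      (eventually_shannonEntropy_sub_le_truncatedDensity hf hδ))).exists
  have hd := isDensity1_truncatedDensity hf hn
  refine ⟨truncatedDensity f n, hd, ⟨_, truncatedDensity_le hn⟩, fun x hx => ?_, ?_,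
    by linarith, Or.inr (hd.shannonNegPart_ne_top_of_bounded (truncatedDensity_le hn)), hent⟩
  · simp [truncatedDensity, Set.indicator_apply, hsupp x hx]
  · have h := (integrable_truncatedDensity_mul hf.1 hfr n).norm.lintegral_lt_top.ne
    simpa [abs_mul, abs_of_nonneg (hd.2.1 _)] using h
end
end

section
/- Let S ⊆ ℝ be measurable and r : ℝ → ℝ measurable. Let f be a probability density supported by S such that ∫ f(x)·r(x) dx = −∞ (i.e., ∫ f·max{−r,0} = ∞ while ∫ f·max{r,0} < ∞) and such that h(f) is defined and exceeds −∞. Then there exists a sequence of probability densities (f̃_k) supported by S for which ∫ f̃_k(x)·|r(x)| dx < ∞ for each k, lim_{k→∞} h(f̃_k) = h(f), and lim_{k→∞} ∫ f̃_k(x)·r(x) dx = −∞. -/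
open MeasureTheory ENNReal Filter

noncomputable section

/-- If `F k → G` pointwise and `F k ≤ 2 * G`, then the integrals converge, even when `∫ G = ∞`. -/
theorem tendsto_lintegral_of_le_two_mul {F : ℕ → ℝ → ℝ≥0∞} {G : ℝ → ℝ≥0∞}
    (hF : ∀ k, Measurable (F k)) (hle : ∀ k x, F k x ≤ 2 * G x)
    (hlim : ∀ x, Tendsto (fun k => F k x) atTop (nhds (G x))) :
    Tendsto (fun k => ∫⁻ x, F k x) atTop (nhds (∫⁻ x, G x)) := by
  by_cases hG : ∫⁻ x, G x = ∞
  · have h := lintegral_liminf_le (μ := volume) (u := atTop) hF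
    simp only [fun x => (hlim x).liminf_eq, hG] at h
    rw [hG]
    exact tendsto_of_le_liminf_of_limsup_le h le_top
  · refine tendsto_lintegral_of_dominated_convergence (fun x => 2 * G x) hF
      (fun k => .of_forall (hle k)) ?_ (.of_forall hlim)
    rw [lintegral_const_mul' _ _ (by simp)]
    exact ENNReal.mul_ne_top (by simp) hG

/-- A density has truncations to the sublevel sets of `|r|`, normalised by constants that are at
most `2` and tend to `1`. -/
theorem exists_normalized_truncation {f r : ℝ → ℝ} (hf : IsDensity1 f) (hr : Measurable r) :
    ∃ (A : ℕ → Set ℝ) (c : ℕ → ℝ), (∀ k, MeasurableSet (A k)) ∧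
      (∀ x, ∀ᶠ k in atTop, x ∈ A k) ∧ (∀ k, ∃ M : ℝ, ∀ x ∈ A k, |r x| ≤ M) ∧
      (∀ k, 1 ≤ c k ∧ c k ≤ 2) ∧ Tendsto c atTop (nhds 1) ∧
      ∀ k, IsDensity1 (fun x => c k * (A k).indicator f x) := by
  obtain ⟨hfm, hf0, hf1⟩ := hf
  set A : ℕ → Set ℝ := fun k => {x | |r x| ≤ k} with hAdef
  have hA : ∀ k, MeasurableSet (A k) := fun k =>
    measurableSet_le (by fun_prop) measurable_const
  have hev : ∀ x, ∀ᶠ k in atTop, x ∈ A k := fun x => by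
    obtain ⟨n, hn⟩ := exists_nat_ge |r x|
    filter_upwards [eventually_ge_atTop n] with k hk
    exact hn.trans (by exact_mod_cast hk)
  have hm : ∀ k, Measurable (fun x => ENNReal.ofReal ((A k).indicator f x)) := fun k =>
    (hfm.indicator (hA k)).ennreal_ofReal
  set p : ℕ → ℝ≥0∞ := fun k => ∫⁻ x, ENNReal.ofReal ((A k).indicator f x) with hp
  have hle : ∀ k x, (A k).indicator f x ≤ f x := fun k x =>
    Set.indicator_le_self' (fun x _ => hf0 x) x
  have hp1 : ∀ k, p k ≤ 1 := fun k => by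
    rw [← hf1]
    exact lintegral_mono fun x => ENNReal.ofReal_le_ofReal (hle k x)
  have hplim : Tendsto p atTop (nhds 1) := by
    rw [← hf1]
    refine tendsto_lintegral_of_le_two_mul hm (fun k x => ?_) fun x => ?_
    · exact (ENNReal.ofReal_le_ofReal (hle k x)).trans (le_mul_of_one_le_left' (by norm_num))
    · refine tendsto_const_nhds.congr' ?_
      filter_upwards [hev x] with k hk
      rw [Set.indicator_of_mem hk]
  obtain ⟨N, hN⟩ := eventually_atTop.1 (hplim.eventually (lt_mem_nhds (ENNReal.inv_lt_one.2
    (by norm_num : (1 : ℝ≥0∞) < 2))))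
  have hN' : ∀ k, 2⁻¹ < p (k + N) := fun k => hN _ (Nat.le_add_left _ _)
  have hp0 : ∀ k, p (k + N) ≠ 0 := fun k => ((zero_le).trans_lt (hN' k)).ne'
  have hpt : ∀ k, p k ≠ ∞ := fun k => ((hp1 k).trans_lt (by simp)).ne
  refine ⟨fun k => A (k + N), fun k => ((p (k + N))⁻¹).toReal, fun k => hA _,
    fun x => (tendsto_add_atTop_nat N).eventually (hev x), fun k => ⟨_, fun x hx => hx⟩,
    fun k => ⟨?_, ?_⟩, ?_, fun k => ⟨?_, fun x => ?_, ?_⟩⟩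
  · rw [← ENNReal.toReal_one]
    exact ENNReal.toReal_mono (by simp [hp0]) (ENNReal.one_le_inv.2 (hp1 _))
  · exact ENNReal.toReal_le_of_le_ofReal (by norm_num)
      (by simpa using (ENNReal.inv_le_iff_inv_le.1 (hN' k).le))
  · have h := (hplim.comp (tendsto_add_atTop_nat N)).inv
    rw [inv_one] at h
    exact (ENNReal.tendsto_toReal one_ne_top).comp h
  · exact (hfm.indicator (hA _)).const_mul _
  · exact mul_nonneg ENNReal.toReal_nonneg (Set.indicator_nonneg (fun x _ => hf0 x) x)
  · simp only [ENNReal.ofReal_mul ENNReal.toReal_nonneg]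
    rw [lintegral_const_mul _ (hm _), ENNReal.ofReal_toReal (by simp [hp0])]
    exact ENNReal.inv_mul_cancel (hp0 k) (hpt _)

/-- Scaling by `c ≥ 1` adds the term `c y log c` to `y log y`. -/
theorem mul_mul_log_mul {c y : ℝ} (hc : 1 ≤ c) :
    c * y * Real.log (c * y) = c * (y * Real.log y) + c * Real.log c * y := by
  rcases eq_or_ne y 0 with rfl | hy
  · simp
  · rw [Real.log_mul (by positivity) hy]
    ring

theorem ofReal_mul_le_two_mul {c a : ℝ} (hc : 0 ≤ c) (hc2 : c ≤ 2) :
    ENNReal.ofReal (c * a) ≤ 2 * ENNReal.ofReal a := by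
  rw [ENNReal.ofReal_mul hc]
  gcongr
  exact ENNReal.ofReal_le_of_le_toReal (by simpa using hc2)

/-- Lemma 4: let `f` be a density supported by `S` with
`∫ f·r = -∞` (i.e. `∫ f·r⁻ = ∞` while `∫ f·r⁺ < ∞`) and with `h(f)` defined and `> -∞`.
Then there is a sequence of densities `f̃ₖ` supported by `S` with `∫ f̃ₖ·|r| < ∞` for each
`k`, `h(f̃ₖ) → h(f)`, and `∫ f̃ₖ·r → -∞`. -/
theorem approximation_of_minus_infinite_cost
    (S : Set ℝ) (hS : MeasurableSet S) (r : ℝ → ℝ) (hr : Measurable r)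
    (f : ℝ → ℝ) (hf : IsDensity1 f) (hsupp : ∀ x ∉ S, f x = 0)
    (hpos : (∫⁻ x, ENNReal.ofReal (f x * r x)) ≠ ∞)
    (hneg : (∫⁻ x, ENNReal.ofReal (-(f x * r x))) = ∞)
    (hdef : ShannonDefined f) (hbot : (⊥ : EReal) < shannonEntropy f) :
    ∃ ftilde : ℕ → ℝ → ℝ,
      (∀ k, IsDensity1 (ftilde k)) ∧
      (∀ k, ∀ x ∉ S, ftilde k x = 0) ∧
      (∀ k, (∫⁻ x, ENNReal.ofReal (ftilde k x * |r x|)) ≠ ∞) ∧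
      (∀ k, ShannonDefined (ftilde k)) ∧
      Tendsto (fun k => shannonEntropy (ftilde k)) atTop (nhds (shannonEntropy f)) ∧
      Tendsto (fun k => ∫ x, ftilde k x * r x) atTop atBot := by
  obtain ⟨A, c, hA, hev, hM, hc, hclim, hdens⟩ := exists_normalized_truncation hf hr
  obtain ⟨hfm, hf0, hf1⟩ := hf
  set g : ℕ → ℝ → ℝ := fun k x => c k * (A k).indicator f x with hg
  have hgm : ∀ k, Measurable (g k) := fun k => (hdens k).1
  have hg0 : ∀ k x, 0 ≤ g k x := fun k => (hdens k).2.1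
  have hc0 : ∀ k, 0 ≤ c k := fun k => zero_le_one.trans (hc k).1
  have hg_cases : ∀ k x, g k x = c k * f x ∨ g k x = 0 := fun k x => by
    by_cases hx : x ∈ A k <;> simp [hg, hx]
  have hglim : ∀ x, Tendsto (fun k => g k x) atTop (nhds (f x)) := fun x => by
    have h := hclim.mul_const (f x)
    rw [one_mul] at h
    refine h.congr' ?_
    filter_upwards [hev x] with k hk
    simp [hg, hk]
  have hlog : ∀ x, Tendsto (fun k => g k x * Real.log (g k x)) atTop
      (nhds (f x * Real.log (f x))) := fun x =>
    (Real.continuous_mul_log.tendsto (f x)).comp (hglim x)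
  have hlogm : ∀ k, Measurable fun x => g k x * Real.log (g k x) := fun k =>
    (hgm k).mul (Real.measurable_log.comp (hgm k))
  have hnegPart : shannonNegPart f ≠ ∞ := by
    intro h
    simp [shannonEntropy, h] at hbot
  set B : ℝ → ℝ≥0∞ := fun x =>
    2 * ENNReal.ofReal (f x * Real.log (f x)) + ENNReal.ofReal (2 * Real.log 2) *
      ENNReal.ofReal (f x) with hB
  have hBfin : ∫⁻ x, B x ≠ ∞ := by
    rw [hB, lintegral_add_right _ (hfm.ennreal_ofReal.const_mul _),
      lintegral_const_mul' _ _ ofNat_ne_top, lintegral_const_mul' _ _ ofReal_ne_top, hf1, mul_one]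
    exact ENNReal.add_ne_top.2 ⟨ENNReal.mul_ne_top ofNat_ne_top hnegPart, ofReal_ne_top⟩
  have hBle : ∀ k x, ENNReal.ofReal (g k x * Real.log (g k x)) ≤ B x := fun k x => by
    rcases hg_cases k x with h | h
    · have hlogc : 0 ≤ Real.log (c k) := Real.log_nonneg (hc k).1
      have hcl : c k * Real.log (c k) ≤ 2 * Real.log 2 :=
        mul_le_mul (hc k).2 (Real.log_le_log (by linarith [(hc k).1]) (hc k).2) hlogc (by norm_num)
      rw [h, mul_mul_log_mul (hc k).1]
      refine ENNReal.ofReal_add_le.trans ?_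
      simp only [hB]
      rw [← ENNReal.ofReal_mul (by positivity)]
      exact add_le_add (ofReal_mul_le_two_mul (hc0 k) (hc k).2)
        (ENNReal.ofReal_le_ofReal (mul_le_mul_of_nonneg_right hcl (hf0 x)))
    · simp [h]
  have hNlim : Tendsto (fun k => shannonNegPart (g k)) atTop (nhds (shannonNegPart f)) :=
    tendsto_lintegral_of_dominated_convergence B (fun k => (hlogm k).ennreal_ofReal)
      (fun k => .of_forall (hBle k)) hBfin
      (.of_forall fun x => (ENNReal.continuous_ofReal.tendsto _).comp (hlog x))
  have hPlim : Tendsto (fun k => shannonPosPart (g k)) atTop (nhds (shannonPosPart f)) := by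
    refine tendsto_lintegral_of_le_two_mul (fun k => (hlogm k).neg.ennreal_ofReal)
      (fun k x => ?_) fun x => (ENNReal.continuous_ofReal.tendsto _).comp (hlog x).neg
    rcases hg_cases k x with h | h
    · rw [h, mul_mul_log_mul (hc k).1]
      refine le_trans (ENNReal.ofReal_le_ofReal ?_)
        (ofReal_mul_le_two_mul (hc0 k) (hc k).2)
      have := mul_nonneg (mul_nonneg (hc0 k) (Real.log_nonneg (hc k).1)) (hf0 x)
      linarith
    · simp [h]
  have hrm : ∀ k, Measurable fun x => g k x * r x := fun k => (hgm k).mul hr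
  have hrlim : ∀ x, Tendsto (fun k => g k x * r x) atTop (nhds (f x * r x)) := fun x =>
    (hglim x).mul_const _
  have hrP : Tendsto (fun k => ∫⁻ x, ENNReal.ofReal (g k x * r x)) atTop
      (nhds (∫⁻ x, ENNReal.ofReal (f x * r x))) := by
    refine tendsto_lintegral_of_le_two_mul (fun k => (hrm k).ennreal_ofReal) (fun k x => ?_)
      fun x => (ENNReal.continuous_ofReal.tendsto _).comp (hrlim x)
    rcases hg_cases k x with h | h
    · rw [h, mul_assoc]
      exact ofReal_mul_le_two_mul (hc0 k) (hc k).2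
    · simp [h]
  have hrN : Tendsto (fun k => ∫⁻ x, ENNReal.ofReal (-(g k x * r x))) atTop (nhds ∞) := by
    rw [← hneg]
    refine tendsto_lintegral_of_le_two_mul (fun k => (hrm k).neg.ennreal_ofReal) (fun k x => ?_)
      fun x => (ENNReal.continuous_ofReal.tendsto _).comp (hrlim x).neg
    rcases hg_cases k x with h | h
    · rw [h, mul_assoc, ← mul_neg]
      exact ofReal_mul_le_two_mul (hc0 k) (hc k).2
    · simp [h]
  have habs : ∀ k, (∫⁻ x, ENNReal.ofReal (g k x * |r x|)) ≠ ∞ := fun k => by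
    obtain ⟨M, hM⟩ := hM k
    refine ne_top_of_le_ne_top (b := ∫⁻ x, ENNReal.ofReal (g k x) * ENNReal.ofReal M) ?_
      (lintegral_mono fun x => ?_)
    · rw [lintegral_mul_const' _ _ (by simp), (hdens k).2.2]
      simp
    · rw [← ENNReal.ofReal_mul (hg0 k x)]
      by_cases hx : x ∈ A k
      · exact ENNReal.ofReal_le_ofReal (mul_le_mul_of_nonneg_left (hM x hx) (hg0 k x))
      · simp [hg, hx]
  have hint : ∀ k, Integrable (fun x => g k x * r x) := fun k => by
    refine ⟨(hrm k).aestronglyMeasurable, ?_⟩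
    rw [hasFiniteIntegral_iff_norm]
    simp only [norm_mul, Real.norm_eq_abs, abs_of_nonneg (hg0 k _)]
    exact (habs k).lt_top
  refine ⟨g, hdens, fun k x hx => ?_, habs, fun k => Or.inr ?_, ?_, ?_⟩
  · simp [hg, hsupp x hx]
  · exact ne_top_of_le_ne_top hBfin (lintegral_mono (hBle k))
  · have hcoe := continuous_coe_ennreal_ereal
    have h1 := (hcoe.tendsto _).comp hPlim
    have h2 := ((hcoe.tendsto _).comp hNlim).neg
    have hadd := EReal.continuousAt_add (p := ((shannonPosPart f : EReal),
      -(shannonNegPart f : EReal))) (Or.inr (by simpa using hnegPart)) (Or.inl (by simp))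
    exact hadd.tendsto.comp (h1.prodMk_nhds h2)
  · simp only [integral_eq_lintegral_pos_part_sub_lintegral_neg_part (hint _), sub_eq_add_neg]
    have h1 := (ENNReal.tendsto_toReal hpos).comp hrP
    refine h1.add_atBot (tendsto_neg_atTop_atBot.comp ?_)
    have hfin : ∀ k, (∫⁻ x, ENNReal.ofReal (-(g k x * r x))) ≠ ∞ := fun k =>
      ne_top_of_le_ne_top (habs k) (lintegral_mono fun x => ENNReal.ofReal_le_ofReal (by
        rw [← mul_neg]
        exact mul_le_mul_of_nonneg_left (neg_le_abs _) (hg0 k x)))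
    refine tendsto_atTop.2 fun b => ?_
    filter_upwards [hrN.eventually (lt_mem_nhds (ENNReal.ofReal_lt_top (r := b)))] with k hk
    exact (ENNReal.ofReal_le_iff_le_toReal (hfin k)).1 hk.le
end
end

section
/- Let S ⊆ ℝ be measurable, r : ℝ → ℝ measurable, and suppose Assumption (A) holds with constant Γ₀. Then on the interval [Γ₀, ∞) the function Γ ↦ h*(Γ) is finite, nondecreasing, and concave, and it is continuous on (Γ₀, ∞). -/
open MeasureTheory ENNReal Filter

noncomputable section

/-- `∫ f(x) r(x) dx ≤ Γ`: the positive part of the integral is finite and the integral,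
with values in the extended reals (possibly `-∞`), is at most `Γ`. -/
def CostLE (f r : ℝ → ℝ) (Γ : ℝ) : Prop :=
  (∫⁻ x, ENNReal.ofReal (f x * r x)) ≠ ∞ ∧
  ((∫⁻ x, ENNReal.ofReal (f x * r x) : ℝ≥0∞) : EReal)
      - ((∫⁻ x, ENNReal.ofReal (-(f x * r x)) : ℝ≥0∞) : EReal) ≤ (Γ : EReal)

/-- `h⋆(Γ)`: the supremum of the Shannon entropy `h(f)` over all densities `f` supported by
`S` with `∫ f·r ≤ Γ` (and with `h(f)` defined); it is `⊥` if no such density exists. -/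
def hStar (S : Set ℝ) (r : ℝ → ℝ) (Γ : ℝ) : EReal :=
  sSup {h : EReal | ∃ f : ℝ → ℝ, IsDensity1 f ∧ (∀ x ∉ S, f x = 0) ∧
    ShannonDefined f ∧ CostLE f r Γ ∧ h = shannonEntropy f}

/-- The extended integral of `u` is not `+∞` and at most `c`. -/
def ExtIntegralLE (u : ℝ → ℝ) (c : ℝ) : Prop :=
  (∫⁻ x, ENNReal.ofReal (u x)) ≠ ∞ ∧
  ((∫⁻ x, ENNReal.ofReal (u x) : ℝ≥0∞) : EReal)
      - ((∫⁻ x, ENNReal.ofReal (-(u x)) : ℝ≥0∞) : EReal) ≤ (c : EReal)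

lemma coe_sub_coe_le_iff {A B : ℝ≥0∞} (hA : A ≠ ∞) (hB : B ≠ ∞) (c : ℝ) :
    (A : EReal) - (B : EReal) ≤ (c : EReal) ↔ A.toReal - B.toReal ≤ c := by
  lift A to NNReal using hA
  lift B to NNReal using hB
  exact EReal.coe_le_coe_iff (x := (A : ℝ) - B) (y := c)

lemma ofReal_add_combo_le {u u₁ u₂ a b : ℝ} (ha : 0 ≤ a) (hb : 0 ≤ b)
    (h : u ≤ a * u₁ + b * u₂) :
    ENNReal.ofReal u +
        (ENNReal.ofReal a * ENNReal.ofReal (-u₁) + ENNReal.ofReal b * ENNReal.ofReal (-u₂)) ≤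
      ENNReal.ofReal (-u) +
        (ENNReal.ofReal a * ENNReal.ofReal u₁ + ENNReal.ofReal b * ENNReal.ofReal u₂) := by
  have key (x : ℝ) : max x 0 - max (-x) 0 = x := max_zero_sub_max_neg_zero_eq_self x
  have hmax (x : ℝ) : ENNReal.ofReal x = ENNReal.ofReal (max x 0) := by simp
  rw [hmax u, hmax u₁, hmax u₂, hmax (-u), hmax (-u₁), hmax (-u₂)]
  simp_rw [← ENNReal.ofReal_mul ha, ← ENNReal.ofReal_mul hb]
  repeat rw [← ENNReal.ofReal_add (by positivity) (by positivity)]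
  apply ENNReal.ofReal_le_ofReal
  have h₁ := congrArg (a * ·) (key u₁)
  have h₂ := congrArg (b * ·) (key u₂)
  simp only [mul_sub] at h₁ h₂
  linarith [key u]

lemma lintegral_combo {g₁ g₂ : ℝ → ℝ} (hg₁ : Measurable g₁) (hg₂ : Measurable g₂) (a b : ℝ) :
    ∫⁻ x, (ENNReal.ofReal a * ENNReal.ofReal (g₁ x) + ENNReal.ofReal b * ENNReal.ofReal (g₂ x)) =
      ENNReal.ofReal a * (∫⁻ x, ENNReal.ofReal (g₁ x)) +
        ENNReal.ofReal b * ∫⁻ x, ENNReal.ofReal (g₂ x) := by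
  rw [lintegral_add_left (by fun_prop), lintegral_const_mul _ (by fun_prop),
    lintegral_const_mul _ (by fun_prop)]

lemma ExtIntegralLE.combo {u u₁ u₂ : ℝ → ℝ} (hu : Measurable u) (hu₁ : Measurable u₁)
    (hu₂ : Measurable u₂) {a b c₁ c₂ : ℝ} (ha : 0 < a) (hb : 0 < b)
    (h₁ : ExtIntegralLE u₁ c₁) (h₂ : ExtIntegralLE u₂ c₂)
    (h : ∀ x, u x ≤ a * u₁ x + b * u₂ x) :
    ExtIntegralLE u (a * c₁ + b * c₂) := by
  obtain ⟨hA₁, hc₁⟩ := h₁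
  obtain ⟨hA₂, hc₂⟩ := h₂
  have hle : ∫⁻ x, ENNReal.ofReal (u x) ≤
      ENNReal.ofReal a * (∫⁻ x, ENNReal.ofReal (u₁ x)) +
        ENNReal.ofReal b * ∫⁻ x, ENNReal.ofReal (u₂ x) := by
    rw [← lintegral_combo hu₁ hu₂]
    refine lintegral_mono fun x => ?_
    rw [← ENNReal.ofReal_mul ha.le, ← ENNReal.ofReal_mul hb.le]
    exact (ENNReal.ofReal_le_ofReal (h x)).trans ENNReal.ofReal_add_le
  have hbal : (∫⁻ x, ENNReal.ofReal (u x)) +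
      (ENNReal.ofReal a * (∫⁻ x, ENNReal.ofReal (-(u₁ x))) +
        ENNReal.ofReal b * ∫⁻ x, ENNReal.ofReal (-(u₂ x))) ≤
      (∫⁻ x, ENNReal.ofReal (-(u x))) + (ENNReal.ofReal a * (∫⁻ x, ENNReal.ofReal (u₁ x)) +
        ENNReal.ofReal b * ∫⁻ x, ENNReal.ofReal (u₂ x)) := by
    rw [← lintegral_combo hu₁ hu₂, ← lintegral_combo (g₁ := fun x => -(u₁ x))
        (g₂ := fun x => -(u₂ x)) hu₁.neg hu₂.neg,
      ← lintegral_add_left (by fun_prop), ← lintegral_add_left (by fun_prop)]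
    exact lintegral_mono fun x => ofReal_add_combo_le ha.le hb.le (h x)
  unfold ExtIntegralLE
  generalize ∫⁻ x, ENNReal.ofReal (u x) = A at *
  generalize ∫⁻ x, ENNReal.ofReal (-(u x)) = B at *
  generalize ∫⁻ x, ENNReal.ofReal (u₁ x) = A₁ at *
  generalize ∫⁻ x, ENNReal.ofReal (-(u₁ x)) = B₁ at *
  generalize ∫⁻ x, ENNReal.ofReal (u₂ x) = A₂ at *
  generalize ∫⁻ x, ENNReal.ofReal (-(u₂ x)) = B₂ at *
  have hfin : ENNReal.ofReal a * A₁ + ENNReal.ofReal b * A₂ ≠ ∞ := by finiteness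
  have hA : A ≠ ∞ := ne_top_of_le_ne_top hfin hle
  refine ⟨hA, ?_⟩
  by_cases hB : B = ∞
  · simp [hB]
  have hsum : A + (ENNReal.ofReal a * B₁ + ENNReal.ofReal b * B₂) ≠ ∞ :=
    ne_top_of_le_ne_top (by finiteness) hbal
  have hB₁ : B₁ ≠ ∞ := by
    rintro rfl
    simp [ENNReal.mul_top, ha] at hsum
  have hB₂ : B₂ ≠ ∞ := by
    rintro rfl
    simp [ENNReal.mul_top, hb] at hsum
  rw [coe_sub_coe_le_iff hA₁ hB₁] at hc₁
  rw [coe_sub_coe_le_iff hA₂ hB₂] at hc₂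
  rw [coe_sub_coe_le_iff hA hB]
  have := ENNReal.toReal_mono (by finiteness) hbal
  rw [ENNReal.toReal_add hA (by finiteness), ENNReal.toReal_add (by finiteness) (by finiteness),
    ENNReal.toReal_add hB (by finiteness), ENNReal.toReal_add (by finiteness) (by finiteness)]
    at this
  simp only [ENNReal.toReal_mul, ENNReal.toReal_ofReal ha.le, ENNReal.toReal_ofReal hb.le] at this
  nlinarith [mul_le_mul_of_nonneg_left hc₁ ha.le, mul_le_mul_of_nonneg_left hc₂ hb.le]

lemma le_shannonEntropy_iff {f : ℝ → ℝ} {c : ℝ} :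
    (c : EReal) ≤ shannonEntropy f ↔ ExtIntegralLE (fun x => f x * Real.log (f x)) (-c) := by
  change (c : EReal) ≤ (shannonPosPart f : EReal) - (shannonNegPart f : EReal) ↔
    shannonNegPart f ≠ ∞ ∧
      (shannonNegPart f : EReal) - (shannonPosPart f : EReal) ≤ ((-c : ℝ) : EReal)
  by_cases hN : shannonNegPart f = ∞
  · simp [hN]
  generalize shannonNegPart f = N at *
  generalize shannonPosPart f = P at *
  lift N to NNReal using hN
  by_cases hP : P = ∞
  · subst hP
    simp
  · rw [coe_sub_coe_le_iff (by simp) hP]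
    lift P to NNReal using hP
    rw [show ((P : ℝ≥0∞) : EReal) - ((N : ℝ≥0∞) : EReal) = (((P : ℝ) - N : ℝ) : EReal) from rfl,
      EReal.coe_le_coe_iff]
    simp only [ENNReal.coe_toReal]
    constructor
    · intro h
      exact ⟨ENNReal.coe_ne_top, by linarith⟩
    · rintro ⟨-, h⟩
      linarith

lemma IsDensity1.combo {f₁ f₂ : ℝ → ℝ} (h₁ : IsDensity1 f₁) (h₂ : IsDensity1 f₂)
    {a b : ℝ} (ha : 0 ≤ a) (hb : 0 ≤ b) (hab : a + b = 1) :
    IsDensity1 (fun x => a * f₁ x + b * f₂ x) := by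
  obtain ⟨hm₁, hp₁, hi₁⟩ := h₁
  obtain ⟨hm₂, hp₂, hi₂⟩ := h₂
  have hp (x : ℝ) : 0 ≤ a * f₁ x ∧ 0 ≤ b * f₂ x :=
    ⟨mul_nonneg ha (hp₁ x), mul_nonneg hb (hp₂ x)⟩
  refine ⟨by fun_prop, fun x => add_nonneg (hp x).1 (hp x).2, ?_⟩
  simp_rw [ENNReal.ofReal_add (hp _).1 (hp _).2, ENNReal.ofReal_mul ha, ENNReal.ofReal_mul hb]
  rw [lintegral_combo hm₁ hm₂, hi₁, hi₂, mul_one, mul_one, ← ENNReal.ofReal_add ha hb, hab,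
    ENNReal.ofReal_one]

lemma hStar_mono (S : Set ℝ) (r : ℝ → ℝ) : Monotone (hStar S r) := by
  intro Γ₁ Γ₂ h
  refine sSup_le_sSup ?_
  rintro _ ⟨f, hd, hs, hh, ⟨hc, hc'⟩, rfl⟩
  exact ⟨f, hd, hs, hh, ⟨hc, hc'.trans (EReal.coe_le_coe_iff.2 h)⟩, rfl⟩

lemma combo_le_hStar {S : Set ℝ} {r : ℝ → ℝ} (hr : Measurable r) {Γ₁ Γ₂ a b c₁ c₂ : ℝ}
    (ha : 0 < a) (hb : 0 < b) (hab : a + b = 1)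
    (h₁ : (c₁ : EReal) < hStar S r Γ₁) (h₂ : (c₂ : EReal) < hStar S r Γ₂) :
    ((a * c₁ + b * c₂ : ℝ) : EReal) ≤ hStar S r (a * Γ₁ + b * Γ₂) := by
  obtain ⟨_, ⟨f₁, hd₁, hs₁, -, hr₁, rfl⟩, hc₁⟩ := lt_sSup_iff.1 h₁
  obtain ⟨_, ⟨f₂, hd₂, hs₂, -, hr₂, rfl⟩, hc₂⟩ := lt_sSup_iff.1 h₂
  have hm₁ := hd₁.1
  have hm₂ := hd₂.1
  have hent : ExtIntegralLE (fun x => (a * f₁ x + b * f₂ x) * Real.log (a * f₁ x + b * f₂ x))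
      (a * -c₁ + b * -c₂) := by
    refine ExtIntegralLE.combo (by fun_prop) (by fun_prop) (by fun_prop) ha hb
      (le_shannonEntropy_iff.1 hc₁.le) (le_shannonEntropy_iff.1 hc₂.le) fun x => ?_
    exact Real.convexOn_mul_log.2 (hd₁.2.1 x) (hd₂.2.1 x) ha.le hb.le hab
  have hcost : ExtIntegralLE (fun x => (a * f₁ x + b * f₂ x) * r x) (a * Γ₁ + b * Γ₂) :=
    ExtIntegralLE.combo (by fun_prop) (hm₁.mul hr) (hm₂.mul hr) ha hb hr₁ hr₂
      fun x => le_of_eq (by simp only [Pi.mul_apply]; ring)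
  have hle : ((a * c₁ + b * c₂ : ℝ) : EReal) ≤ shannonEntropy (fun x => a * f₁ x + b * f₂ x) := by
    rw [le_shannonEntropy_iff]
    convert hent using 1
    ring
  refine hle.trans (le_sSup ⟨_, hd₁.combo hd₂ ha.le hb.le hab, fun x hx => ?_, Or.inr hent.1,
    hcost, rfl⟩)
  simp [hs₁ x hx, hs₂ x hx]

/-- Proposition 1, first part: under Assumption (A) with constant `Γ₀`,
the function `Γ ↦ h⋆(Γ)` is finite, nondecreasing and concave on `[Γ₀, ∞)`, and continuous
on `(Γ₀, ∞)`. -/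
theorem hStar_properties
    (S : Set ℝ) (hS : MeasurableSet S) (r : ℝ → ℝ) (hr : Measurable r)
    (Γ₀ : ℝ) (hA1 : (⊥ : EReal) < hStar S r Γ₀) (hA2 : ∀ Γ' ≥ Γ₀, hStar S r Γ' < ⊤) :
    (∀ Γ ∈ Set.Ici Γ₀, hStar S r Γ ≠ ⊥ ∧ hStar S r Γ ≠ ⊤) ∧
    MonotoneOn (fun Γ => hStar S r Γ) (Set.Ici Γ₀) ∧
    ConcaveOn ℝ (Set.Ici Γ₀) (fun Γ => (hStar S r Γ).toReal) ∧
    ContinuousOn (fun Γ => hStar S r Γ) (Set.Ioi Γ₀) := by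
  have hmono := hStar_mono S r
  have hfin : ∀ Γ ∈ Set.Ici Γ₀, hStar S r Γ ≠ ⊥ ∧ hStar S r Γ ≠ ⊤ := fun Γ hΓ =>
    ⟨(hA1.trans_le (hmono hΓ)).ne', (hA2 Γ hΓ).ne⟩
  have hcoe : ∀ Γ ∈ Set.Ici Γ₀, ((hStar S r Γ).toReal : EReal) = hStar S r Γ := fun Γ hΓ =>
    EReal.coe_toReal (hfin Γ hΓ).2 (hfin Γ hΓ).1
  have hconc : ConcaveOn ℝ (Set.Ici Γ₀) (fun Γ => (hStar S r Γ).toReal) := by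
    refine concaveOn_iff_forall_pos.2 ⟨convex_Ici Γ₀, ?_⟩
    intro Γ₁ h₁ Γ₂ h₂ a b ha hb hab
    have h₃ := (convex_Ici Γ₀) h₁ h₂ ha.le hb.le hab
    simp only [smul_eq_mul] at h₃ ⊢
    refine le_of_forall_pos_sub_le fun ε hε => ?_
    have hlt : ∀ Γ ∈ Set.Ici Γ₀, (((hStar S r Γ).toReal - ε : ℝ) : EReal) < hStar S r Γ :=
      fun Γ hΓ => by
        conv_rhs => rw [← hcoe Γ hΓ]
        exact EReal.coe_lt_coe_iff.2 (sub_lt_self _ hε)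
    have := combo_le_hStar hr ha hb hab (hlt Γ₁ h₁) (hlt Γ₂ h₂)
    rw [← hcoe _ h₃, EReal.coe_le_coe_iff] at this
    have hε' : a * ε + b * ε = ε := by rw [← add_mul, hab, one_mul]
    linarith
  refine ⟨hfin, hmono.monotoneOn _, hconc, ?_⟩
  have hcont := hconc.continuousOn_interior
  rw [interior_Ici] at hcont
  exact (continuous_coe_real_ereal.comp_continuousOn hcont).congr
    fun Γ hΓ => (hcoe Γ (Set.mem_Ici_of_Ioi hΓ)).symm
end
end

section
/- Let p ∈ ℕ and α₀, …, α_p ∈ ℝ be such that the (p+1)×(p+1) Toeplitz matrix with Row-ℓ Column-m entry α_{|ℓ−m|} is positive definite, and let 0 < α < 1. Then the supremum, over all one-sided stochastic processes (X_i)_{i∈ℕ} satisfying E[X_i X_{i+k}] = α_k for every i ∈ ℕ and every k ∈ {0, …, p}, of the order-α Rényi rate (over those processes for which the rate is defined) equals +∞; that is, for every M ∈ ℝ there is such a process whose order-α Rényi rate is defined and exceeds M. -/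
open MeasureTheory ENNReal Filter

noncomputable section

/-- The first `n` coordinates `(X₁, …, X_n)` of a one-sided path. -/
def nvec (n : ℕ) : (ℕ → ℝ) → (Fin n → ℝ) := fun ω i => ω i

/-- `F n` is a probability density of the random vector `(X₁, …, X_n)` under `μ`,
for every `n`. -/
def HasDensityFamilyNat (μ : Measure (ℕ → ℝ)) (F : (n : ℕ) → (Fin n → ℝ) → ℝ) : Prop :=
  ∀ n, IsDensity (F n) ∧
    Measure.map (nvec n) μ = volume.withDensity (fun x => ENNReal.ofReal (F n x))

/-- The order-`α` Rényi rate of a process whose `n`-dimensional marginal densities are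
`F n` is defined and equals `L`, i.e. `(1/n)·h_α(F n) → L`. -/
def HasRenyiRate (F : (n : ℕ) → (Fin n → ℝ) → ℝ) (α : ℝ) (L : EReal) : Prop :=
  Tendsto (fun n : ℕ => (((n : ℝ)⁻¹ : ℝ) : EReal) * renyiEntropy (F n) α) atTop (nhds L)

/-- The process `(X_i)_{i∈ℕ}` with law `μ` satisfies the autocovariance constraints
`E[X_i X_{i+k}] = a k` for every `i` and every `k ∈ {0, …, p}`. -/
def SatisfiesBurgConstraints (μ : Measure (ℕ → ℝ)) (p : ℕ) (a : ℕ → ℝ) : Prop :=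
  ∀ i : ℕ, ∀ k ≤ p, Integrable (fun ω => ω i * ω (i + k)) μ ∧
    ∫ ω, ω i * ω (i + k) ∂μ = a k

/-- The `(p+1) × (p+1)` Toeplitz matrix whose Row-`ℓ` Column-`m` entry is `a |ℓ - m|`. -/
def toeplitz (p : ℕ) (a : ℕ → ℝ) : Matrix (Fin (p + 1)) (Fin (p + 1)) ℝ :=
  Matrix.of fun ℓ m => a ((ℓ : ℤ) - (m : ℤ)).natAbs

/-- The top-left `p × p` submatrix of the Toeplitz matrix. -/
def toeplitzSub (p : ℕ) (a : ℕ → ℝ) : Matrix (Fin p) (Fin p) ℝ :=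
  Matrix.of fun ℓ m => a ((ℓ : ℤ) - (m : ℤ)).natAbs

theorem exists_extension_vector (q : ℕ) (b : ℕ → ℝ) (hpos : (toeplitz q b).PosDef) (n : ℕ)
    (w : Fin q → ℕ → ℝ)
    (hw : ∀ l m : Fin q, ∑ j ∈ Finset.range n, w l j * w m j = b ((l : ℤ) - (m : ℤ)).natAbs) :
    ∃ u : ℕ → ℝ, (∀ j > n, u j = 0) ∧ u n ≠ 0 ∧
      (∀ l : Fin q, ∑ j ∈ Finset.range n, w l j * u j = b (q - l)) ∧
      ∑ j ∈ Finset.range (n + 1), u j * u j = b 0 := by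
  set G : Matrix (Fin q) (Fin q) ℝ := toeplitzSub q b with hG
  have hGpos : G.PosDef := by
    exact hpos.submatrix (e := Fin.castSucc) (Fin.castSucc_injective q)
  set r : Fin q → ℝ := fun l => b (q - l) with hr
  set c : Fin q → ℝ := G⁻¹.mulVec r with hc
  have hGc : G.mulVec c = r := by
    rw [hc, Matrix.mulVec_mulVec, Matrix.mul_nonsing_inv, Matrix.one_mulVec]
    exact (Matrix.isUnit_iff_isUnit_det _).1 hGpos.isUnit
  have hGc' : ∀ l, ∑ m, G l m * c m = r l := fun l => congrFun hGc l
  have hGe : ∀ l m : Fin q, ∑ j ∈ Finset.range n, w l j * w m j = G l m := hw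
  set u0 : ℕ → ℝ := fun j => ∑ m, c m * w m j with hu0
  have h1 : ∀ l, ∑ j ∈ Finset.range n, w l j * u0 j = r l := by
    intro l
    simp only [hu0, Finset.mul_sum]
    rw [Finset.sum_comm, ← hGc' l]
    refine Finset.sum_congr rfl fun m _ => ?_
    rw [← hGe, Finset.sum_mul]
    exact Finset.sum_congr rfl fun j _ => by ring
  have h2 : ∑ j ∈ Finset.range n, u0 j * u0 j = ∑ m, c m * r m := by
    calc _ = ∑ j ∈ Finset.range n, ∑ m, c m * (w m j * u0 j) := by
          refine Finset.sum_congr rfl fun j _ => ?_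
          conv_lhs => rw [hu0]
          simp only [Finset.sum_mul]
          refine Finset.sum_congr rfl fun m _ => by ring
      _ = _ := by
          rw [Finset.sum_comm]
          refine Finset.sum_congr rfl fun m _ => ?_
          rw [← Finset.mul_sum, h1]
  have h3 : 0 < b 0 - ∑ m, c m * r m := by
    have hne : (Fin.snoc c (-1) : Fin (q + 1) → ℝ) ≠ 0 := by
      intro h
      have := congrFun h (Fin.last q)
      simp at this
    have h := hpos.dotProduct_mulVec_pos hne
    have e1 : ∀ l m : Fin q, toeplitz q b l.castSucc m.castSucc = G l m := fun l m => rfl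
    have e2 : ∀ l : Fin q, toeplitz q b l.castSucc (Fin.last q) = r l := fun l => by
      simp only [toeplitz, Matrix.of_apply, hr]
      congr 1
      have := l.2
      simp
      omega
    have e3 : ∀ l : Fin q, toeplitz q b (Fin.last q) l.castSucc = r l := fun l => by
      simp only [toeplitz, Matrix.of_apply, hr]
      congr 1
      have := l.2
      simp
      omega
    have e4 : toeplitz q b (Fin.last q) (Fin.last q) = b 0 := by
      simp [toeplitz]
    simp only [dotProduct, Matrix.mulVec, Fin.sum_univ_castSucc, Pi.star_apply, star_trivial,
      Fin.snoc_castSucc, Fin.snoc_last, e1, e2, e3, e4, hGc'] at h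
    have e5 : ∑ m, r m * c m = ∑ m, c m * r m := Finset.sum_congr rfl fun m _ => mul_comm _ _
    simp only [mul_neg, mul_one] at h
    rw [e5] at h
    simp at h
    linarith
  refine ⟨fun j => if j < n then u0 j else if j = n then √(b 0 - ∑ m, c m * r m) else 0,
    ?_, ?_, ?_, ?_⟩
  · intro j hj
    simp [hj.not_gt, hj.ne']
  · simp [(Real.sqrt_pos.2 h3).ne']
  · intro l
    rw [← show r l = b (q - l) from rfl, ← h1 l]
    refine Finset.sum_congr rfl fun j hj => ?_
    simp [Finset.mem_range.1 hj]
  · rw [Finset.sum_range_succ]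
    simp only [lt_irrefl, if_false, if_true]
    rw [Real.mul_self_sqrt h3.le,
      show b 0 = ∑ j ∈ Finset.range n, u0 j * u0 j + (b 0 - ∑ m, c m * r m) by rw [h2]; ring]
    congr 1
    · refine Finset.sum_congr rfl fun j hj => ?_
      simp [Finset.mem_range.1 hj]
    · rw [h2]; ring

/-- The first `n` rows of `v` form a lower triangular array with nonzero diagonal, and rows at
distance `k ≤ p` have inner product `b k`. -/
def IsTriangularFactor (p : ℕ) (b : ℕ → ℝ) (n : ℕ) (v : ℕ → ℕ → ℝ) : Prop :=
  ∀ i < n, (∀ j > i, v i j = 0) ∧ v i i ≠ 0 ∧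
    ∀ k ≤ p, i + k < n → ∑ j ∈ Finset.range (i + 1), v i j * v (i + k) j = b k

theorem toeplitz_posDef_of_le {p q : ℕ} {b : ℕ → ℝ} (hpos : (toeplitz p b).PosDef) (h : q ≤ p) :
    (toeplitz q b).PosDef := by
  exact hpos.submatrix (e := Fin.castLE (Nat.succ_le_succ h)) (Fin.castLE_injective _)

theorem sum_range_eq_of_triangular {u v : ℕ → ℝ} {i m : ℕ} (h : ∀ j > i, u j = 0) (him : i < m) :
    ∑ j ∈ Finset.range m, u j * v j = ∑ j ∈ Finset.range (i + 1), u j * v j := by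
  symm
  refine Finset.sum_subset (by simpa using him) fun j _ hj => ?_
  rw [h j (by simpa using hj), zero_mul]

theorem IsTriangularFactor.exists_succ {p : ℕ} {b : ℕ → ℝ} (hpos : (toeplitz p b).PosDef) {n : ℕ}
    {v : ℕ → ℕ → ℝ} (hv : IsTriangularFactor p b n v) :
    ∃ v', IsTriangularFactor p b (n + 1) v' ∧ ∀ i < n, v' i = v i := by
  set q := min p n with hq
  have hqp : q ≤ p := min_le_left _ _
  have hqn : q ≤ n := min_le_right _ _
  have hw : ∀ l m : Fin q, l ≤ m → ∑ j ∈ Finset.range n, v (n - q + l) j * v (n - q + m) j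
      = b ((l : ℤ) - (m : ℤ)).natAbs := by
    intro l m hlm
    have hl := l.2
    have hm := m.2
    have hlm' : (l : ℕ) ≤ m := hlm
    obtain ⟨z, -, g⟩ := hv (n - q + l) (by omega)
    rw [sum_range_eq_of_triangular z (by omega)]
    have := g (m - l) (by omega) (by omega)
    rw [show n - q + (l : ℕ) + (m - l) = n - q + m by omega] at this
    rw [this]
    congr 1
    omega
  obtain ⟨u, hu1, hu2, hu3, hu4⟩ := exists_extension_vector q b (toeplitz_posDef_of_le hpos hqp) n
    (fun l => v (n - q + l)) (by
      intro l m
      rcases le_total l m with h | h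
      · exact hw l m h
      · have := hw m l h
        simp only [mul_comm (v (n - q + (m : ℕ)) _)] at this
        rw [this]
        congr 1
        omega)
  refine ⟨Function.update v n u, ?_, fun i hi => Function.update_of_ne hi.ne _ _⟩
  intro i hi
  rcases Nat.lt_succ_iff_lt_or_eq.1 hi with hi | rfl
  · obtain ⟨z, d, g⟩ := hv i hi
    rw [Function.update_of_ne hi.ne]
    refine ⟨z, d, fun k hk hik => ?_⟩
    rcases Nat.lt_succ_iff_lt_or_eq.1 hik with hik | hik
    · rw [Function.update_of_ne hik.ne]
      exact g k hk hik
    · rw [hik, Function.update_self]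
      have := hu3 ⟨i - (n - q), by omega⟩
      simp only at this
      rw [show n - q + (i - (n - q)) = i by omega,
        show q - (i - (n - q)) = k by omega, sum_range_eq_of_triangular z hi] at this
      exact this
  · rw [Function.update_self]
    refine ⟨hu1, hu2, fun k hk hik => ?_⟩
    obtain rfl : k = 0 := by omega
    simpa using hu4

theorem exists_triangularFactor {p : ℕ} {b : ℕ → ℝ} (hpos : (toeplitz p b).PosDef) :
    ∃ v : ℕ → ℕ → ℝ, ∀ n, IsTriangularFactor p b n v := by
  choose! f hf1 hf2 using fun n v => IsTriangularFactor.exists_succ (n := n) (v := v) hpos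
  set S : ℕ → ℕ → ℕ → ℝ := fun n => Nat.rec (fun _ _ => 0) (fun n v => f n v) n with hS
  have hSs : ∀ n, S (n + 1) = f n (S n) := fun n => rfl
  have hgood : ∀ n, IsTriangularFactor p b n (S n) := by
    intro n
    induction n with
    | zero => intro i hi; omega
    | succ n ih => exact hSs n ▸ hf1 _ _ ih
  have hstab : ∀ i n, i < n → S n i = S (i + 1) i := by
    intro i n hn
    induction n, hn using Nat.le_induction with
    | base => rfl
    | succ n hn ih => rw [hSs, hf2 _ _ (hgood n) i hn, ih]
  refine ⟨fun i => S (i + 1) i, fun n i hi => ?_⟩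
  obtain ⟨z, d, g⟩ := hgood n i hi
  simp only [← hstab i n hi]
  refine ⟨z, d, fun k hk hik => ?_⟩
  simp only [← hstab (i + k) n hik]
  exact g k hk hik

open ProbabilityTheory in
/-- The uniform probability measure on `[-2^k, 2^k]`. -/
def dyadicUniform (k : ℕ) : Measure ℝ := cond volume (Set.Icc (-2 ^ k) (2 ^ k))

theorem volume_dyadicIcc (k : ℕ) :
    volume (Set.Icc (-2 ^ k : ℝ) (2 ^ k)) = ENNReal.ofReal (2 * 2 ^ k) := by
  rw [Real.volume_Icc]
  congr 1
  ring

instance (k : ℕ) : IsProbabilityMeasure (dyadicUniform k) :=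
  ProbabilityTheory.cond_isProbabilityMeasure_of_finite
    (by rw [volume_dyadicIcc]; positivity) (by simp)

theorem ae_dyadicUniform_abs_le (k : ℕ) : ∀ᵐ x ∂dyadicUniform k, |x| ≤ 2 ^ k := by
  filter_upwards [ProbabilityTheory.ae_cond_mem (μ := volume)
    (measurableSet_Icc (a := (-2 ^ k : ℝ)) (b := 2 ^ k))] with x hx
  exact abs_le.2 hx

theorem integral_dyadicUniform (k : ℕ) (f : ℝ → ℝ) :
    ∫ x, f x ∂dyadicUniform k = (2 * 2 ^ k)⁻¹ * ∫ x in (-2 ^ k : ℝ)..2 ^ k, f x := by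
  have h : (-2 ^ k : ℝ) ≤ 2 ^ k := by linarith [pow_pos (two_pos : (0 : ℝ) < 2) k]
  rw [dyadicUniform, ProbabilityTheory.cond, integral_smul_measure, volume_dyadicIcc,
    intervalIntegral.integral_of_le h, integral_Icc_eq_integral_Ioc, ENNReal.toReal_inv,
    ENNReal.toReal_ofReal (by positivity), smul_eq_mul]

theorem integral_id_dyadicUniform (k : ℕ) : ∫ x, x ∂dyadicUniform k = 0 := by
  simp [integral_dyadicUniform k (fun x => x)]

theorem integral_sq_dyadicUniform (k : ℕ) : ∫ x, x * x ∂dyadicUniform k = 4 ^ k / 3 := by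
  have h : (2 : ℝ) ^ k ≠ 0 := by positivity
  simp_rw [← sq]
  rw [integral_dyadicUniform k (fun x => x ^ 2), integral_pow,
    show (4 : ℝ) ^ k = 2 ^ k * 2 ^ k by rw [← mul_pow]; norm_num]
  push_cast
  field_simp
  ring

/-- Independent coordinates, each uniform on `[-2^k, 2^k]`. -/
def dyadicCube (k : ℕ) : Measure (ℕ → ℝ) := Measure.infinitePi fun _ => dyadicUniform k

instance (k : ℕ) : IsProbabilityMeasure (dyadicCube k) := by
  unfold dyadicCube; infer_instance

theorem ae_dyadicCube_abs_le (k i : ℕ) : ∀ᵐ ω ∂dyadicCube k, |ω i| ≤ 2 ^ k := by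
  have h := ae_dyadicUniform_abs_le k
  rw [← Measure.infinitePi_map_eval (fun _ => dyadicUniform k) i] at h
  exact ae_of_ae_map (measurable_pi_apply i).aemeasurable h

theorem ae_dyadicCube_abs_mul_le (k i j : ℕ) : ∀ᵐ ω ∂dyadicCube k, |ω i * ω j| ≤ 4 ^ k := by
  filter_upwards [ae_dyadicCube_abs_le k i, ae_dyadicCube_abs_le k j] with ω hi hj
  rw [abs_mul, show (4 : ℝ) ^ k = 2 ^ k * 2 ^ k by rw [← mul_pow]; norm_num]
  gcongr

theorem integrable_mul_dyadicCube (k i j : ℕ) :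
    Integrable (fun ω => ω i * ω j) (dyadicCube k) :=
  Integrable.of_bound (by fun_prop) (4 ^ k) (ae_dyadicCube_abs_mul_le k i j)

theorem integral_mul_dyadicCube (k i j : ℕ) :
    ∫ ω, ω i * ω j ∂dyadicCube k = if i = j then 4 ^ k / 3 else 0 := by
  split_ifs with h
  · subst h
    rw [← integral_sq_dyadicUniform k,
      ← Measure.infinitePi_map_eval (fun _ => dyadicUniform k) i,
      integral_map (measurable_pi_apply i).aemeasurable (by fun_prop)]
    rfl
  · have e : ∀ i, ∫ ω, ω i ∂dyadicCube k = 0 := fun i => by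
      rw [← integral_id_dyadicUniform k,
        ← Measure.infinitePi_map_eval (fun _ => dyadicUniform k) i,
        integral_map (measurable_pi_apply i).aemeasurable (by fun_prop)]
      rfl
    have hind : ProbabilityTheory.IndepFun (fun ω : ℕ → ℝ => ω i) (fun ω => ω j) (dyadicCube k) :=
      (ProbabilityTheory.iIndepFun_infinitePi (P := fun _ : ℕ => dyadicUniform k)
        (X := fun _ x => x) (by fun_prop)).indepFun h
    have := hind.integral_fun_mul_eq_mul_integral
      (measurable_pi_apply i).aestronglyMeasurable (measurable_pi_apply j).aestronglyMeasurable
    rw [this, e, zero_mul]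

/-- The weight of the `k`-th scale in the mixture. -/
def mixWeight (k : ℕ) : ℝ := 7 / 8 * (1 / 8) ^ k

theorem mixWeight_pos (k : ℕ) : 0 < mixWeight k := by unfold mixWeight; positivity

theorem hasSum_mixWeight : HasSum mixWeight 1 := by
  have := (hasSum_geometric_of_lt_one (r := (1 / 8 : ℝ)) (by norm_num) (by norm_num)).mul_left
    (7 / 8)
  rwa [show (7 / 8 : ℝ) * (1 - 1 / 8)⁻¹ = 1 by norm_num] at this

theorem hasSum_mixWeight_mul : HasSum (fun k => mixWeight k * 4 ^ k) (7 / 4) := by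
  have := (hasSum_geometric_of_lt_one (r := (1 / 2 : ℝ)) (by norm_num) (by norm_num)).mul_left
    (7 / 8)
  rw [show (7 / 8 : ℝ) * (1 - 1 / 2)⁻¹ = 7 / 4 by norm_num] at this
  refine this.congr_fun fun k => ?_
  simp only [mixWeight]
  rw [mul_assoc, ← mul_pow]
  norm_num

/-- A heavy-tailed scale mixture of uniform measures on cubes. -/
def cubeMixture : Measure (ℕ → ℝ) :=
  Measure.sum fun k => ENNReal.ofReal (mixWeight k) • dyadicCube k

instance : IsProbabilityMeasure cubeMixture := by
  constructor
  simp only [cubeMixture, Measure.sum_apply _ MeasurableSet.univ, Measure.smul_apply, measure_univ,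
    smul_eq_mul, mul_one]
  rw [← ENNReal.ofReal_tsum_of_nonneg (fun k => (mixWeight_pos k).le) hasSum_mixWeight.summable,
    hasSum_mixWeight.tsum_eq, ENNReal.ofReal_one]

theorem integrable_mul_cubeMixture (i j : ℕ) :
    Integrable (fun ω => ω i * ω j) cubeMixture := by
  refine integrable_sum_measure
    (fun k => (integrable_mul_dyadicCube k i j).smul_measure ENNReal.ofReal_ne_top) ?_
  refine Summable.of_nonneg_of_le (fun k => integral_nonneg fun _ => norm_nonneg _) (fun k => ?_)
    hasSum_mixWeight_mul.summable
  rw [integral_smul_measure, ENNReal.toReal_ofReal (mixWeight_pos k).le, smul_eq_mul]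
  refine mul_le_mul_of_nonneg_left ?_ (mixWeight_pos k).le
  calc ∫ ω, ‖ω i * ω j‖ ∂dyadicCube k ≤ ∫ _, (4 : ℝ) ^ k ∂dyadicCube k :=
        integral_mono_ae (integrable_mul_dyadicCube k i j).norm (integrable_const _)
          (ae_dyadicCube_abs_mul_le k i j)
    _ = 4 ^ k := by simp

theorem integral_mul_cubeMixture (i j : ℕ) :
    ∫ ω, ω i * ω j ∂cubeMixture = if i = j then 7 / 12 else 0 := by
  rw [cubeMixture, integral_sum_measure (integrable_mul_cubeMixture i j)]
  simp_rw [integral_smul_measure, integral_mul_dyadicCube,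
    ENNReal.toReal_ofReal (mixWeight_pos _).le]
  split_ifs
  · simp_rw [smul_eq_mul, ← mul_div_assoc]
    rw [tsum_div_const, hasSum_mixWeight_mul.tsum_eq]
    norm_num
  · simp

theorem integrable_and_integral_sum_mul_sum (s t : Finset ℕ) (u v : ℕ → ℝ) (hst : s ⊆ t) :
    Integrable (fun ω => (∑ j ∈ s, u j * ω j) * ∑ j ∈ t, v j * ω j) cubeMixture ∧
    ∫ ω, (∑ j ∈ s, u j * ω j) * ∑ j ∈ t, v j * ω j ∂cubeMixture =
      7 / 12 * ∑ j ∈ s, u j * v j := by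
  have hint : ∀ i j, Integrable (fun ω => u i * v j * (ω i * ω j)) cubeMixture :=
    fun i j => (integrable_mul_cubeMixture i j).const_mul _
  have e : (fun ω : ℕ → ℝ => (∑ j ∈ s, u j * ω j) * ∑ j ∈ t, v j * ω j) =
      fun ω => ∑ i ∈ s, ∑ j ∈ t, u i * v j * (ω i * ω j) := by
    ext ω
    rw [Finset.sum_mul_sum]
    exact Finset.sum_congr rfl fun i _ => Finset.sum_congr rfl fun j _ => by ring
  rw [e]
  refine ⟨integrable_finsetSum _ fun i _ => integrable_finsetSum _ fun j _ => hint i j, ?_⟩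
  rw [integral_finsetSum _ fun i _ => integrable_finsetSum _ fun j _ => hint i j, Finset.mul_sum]
  refine Finset.sum_congr rfl fun i hi => ?_
  rw [integral_finsetSum _ fun j _ => hint i j]
  simp_rw [integral_const_mul, integral_mul_cubeMixture]
  simp only [mul_ite, mul_zero, Finset.sum_ite_eq, hst hi, if_true]
  ring

/-- The causal linear filter whose `i`-th output is `∑_{j ≤ i} v i j ω j`. -/
def causalFilter (v : ℕ → ℕ → ℝ) (ω : ℕ → ℝ) : ℕ → ℝ :=
  fun i => ∑ j ∈ Finset.range (i + 1), v i j * ω j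

theorem measurable_causalFilter (v : ℕ → ℕ → ℝ) : Measurable (causalFilter v) := by
  unfold causalFilter; fun_prop

theorem measurable_nvec (n : ℕ) : Measurable (nvec n) := by
  unfold nvec; fun_prop

theorem satisfiesBurgConstraints_causalFilter {p : ℕ} {a b : ℕ → ℝ} {v : ℕ → ℕ → ℝ}
    (hv : ∀ n, IsTriangularFactor p b n v) (hab : ∀ k, 7 / 12 * b k = a k) :
    SatisfiesBurgConstraints (cubeMixture.map (causalFilter v)) p a := by
  intro i k hk
  have h := integrable_and_integral_sum_mul_sum (Finset.range (i + 1)) (Finset.range (i + k + 1))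
    (v i) (v (i + k)) (by simp)
  have hg : AEStronglyMeasurable (fun ω : ℕ → ℝ => ω i * ω (i + k))
      (cubeMixture.map (causalFilter v)) := by fun_prop
  refine ⟨(integrable_map_measure hg (measurable_causalFilter v).aemeasurable).2 h.1, ?_⟩
  rw [integral_map (measurable_causalFilter v).aemeasurable hg]
  refine h.2.trans ?_
  rw [((hv (i + k + 1)) i (by omega)).2.2 k hk (by omega), hab]

theorem map_nvec_dyadicCube (k n : ℕ) :
    (dyadicCube k).map (nvec n) = ProbabilityTheory.cond volume
      (Set.univ.pi fun _ : Fin n => Set.Icc (-2 ^ k : ℝ) (2 ^ k)) := by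
  have h1 : (dyadicCube k).map (nvec n) = Measure.pi fun _ : Fin n => dyadicUniform k := by
    rw [← Measure.infinitePi_eq_pi]
    exact Measure.map_infinitePi_infinitePi_of_inj (P := fun _ : ℕ => dyadicUniform k)
      (f := fun i : Fin n => (i : ℕ)) Fin.val_injective
  rw [h1]
  refine Measure.pi_eq fun s hs => ?_
  rw [ProbabilityTheory.cond_apply (MeasurableSet.univ_pi fun _ => measurableSet_Icc),
    ← Set.pi_inter_distrib, volume_pi_pi, volume_pi_pi,
    ENNReal.prod_inv_distrib (by simp [Set.Pairwise]), ← Finset.prod_mul_distrib]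
  refine Finset.prod_congr rfl fun i _ => ?_
  rw [dyadicUniform, ProbabilityTheory.cond_apply measurableSet_Icc]

theorem map_linearMap_cond {n : ℕ} {f : (Fin n → ℝ) →ₗ[ℝ] (Fin n → ℝ)}
    (hf : LinearMap.det f ≠ 0) {B : Set (Fin n → ℝ)} (hB : MeasurableSet B) :
    (ProbabilityTheory.cond volume B).map f = ProbabilityTheory.cond volume (f '' B) := by
  have hfm : Measurable f := f.continuous_of_finiteDimensional.measurable
  have hinj : Function.Injective f := (f.equivOfDetNeZero hf).injective
  ext s hs
  rw [Measure.map_apply hfm hs, ProbabilityTheory.cond_apply hB,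
    ProbabilityTheory.cond_apply' hs, ← Set.image_inter_preimage,
    Measure.addHaar_image_linearMap, Measure.addHaar_image_linearMap]
  have h0 : ENNReal.ofReal |LinearMap.det f| ≠ 0 := by simpa using hf
  rw [ENNReal.mul_inv (.inl h0) (.inl ENNReal.ofReal_ne_top), mul_mul_mul_comm,
    ENNReal.inv_mul_cancel h0 ENNReal.ofReal_ne_top, one_mul]

/-- The `n × n` truncation of a lower triangular array. -/
def triangularMatrix (v : ℕ → ℕ → ℝ) (n : ℕ) : Matrix (Fin n) (Fin n) ℝ :=
  Matrix.of fun i j => v i j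

theorem IsTriangularFactor.det_ne_zero {p : ℕ} {b : ℕ → ℝ} {v : ℕ → ℕ → ℝ} {n : ℕ}
    (hv : IsTriangularFactor p b n v) :
    LinearMap.det (Matrix.toLin' (triangularMatrix v n)) ≠ 0 := by
  rw [LinearMap.det_toLin', Matrix.det_of_isLowerTriangular]
  · exact Finset.prod_ne_zero_iff.2 fun i _ => (hv i i.2).2.1
  · intro i j hij
    exact (hv i i.2).1 j hij

theorem IsTriangularFactor.nvec_causalFilter {p : ℕ} {b : ℕ → ℝ} {v : ℕ → ℕ → ℝ} {n : ℕ}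
    (hv : IsTriangularFactor p b n v) (ω : ℕ → ℝ) :
    nvec n (causalFilter v ω) = Matrix.toLin' (triangularMatrix v n) (nvec n ω) := by
  ext i
  rw [Matrix.toLin'_apply]
  simp only [nvec, causalFilter, Matrix.mulVec, dotProduct, triangularMatrix, Matrix.of_apply]
  rw [Fin.sum_univ_eq_sum_range (fun j => v i j * ω j) n,
    sum_range_eq_of_triangular (hv i i.2).1 i.2]

theorem IsTriangularFactor.map_nvec {p : ℕ} {b : ℕ → ℝ} {v : ℕ → ℕ → ℝ} {n : ℕ}
    (hv : IsTriangularFactor p b n v) :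
    (cubeMixture.map (causalFilter v)).map (nvec n) =
      Measure.sum fun k => ENNReal.ofReal (mixWeight k) • ProbabilityTheory.cond volume
        (Matrix.toLin' (triangularMatrix v n) ''
          Set.univ.pi fun _ : Fin n => Set.Icc (-2 ^ k : ℝ) (2 ^ k)) := by
  set f := Matrix.toLin' (triangularMatrix v n) with hf
  have hfm : Measurable f := f.continuous_of_finiteDimensional.measurable
  have hcomp : nvec n ∘ causalFilter v = f ∘ nvec n := funext hv.nvec_causalFilter
  rw [Measure.map_map (measurable_nvec n) (measurable_causalFilter v), hcomp, cubeMixture,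
    Measure.map_sum (hfm.comp (measurable_nvec n)).aemeasurable]
  congr 1
  ext1 k
  rw [Measure.map_smul, ← Measure.map_map hfm (measurable_nvec n), map_nvec_dyadicCube,
    map_linearMap_cond hv.det_ne_zero (MeasurableSet.univ_pi fun _ => measurableSet_Icc)]

/-- A density dominating `c` times Lebesgue measure on `A` has order-`α` integral at least
`c ^ α` times the volume of `A`. -/
theorem le_renyiIntegral {n : ℕ} {f : (Fin n → ℝ) → ℝ} {c α : ℝ}
    (hα : 0 < α) (hc : 0 ≤ c) {A : Set (Fin n → ℝ)} (hA : MeasurableSet A)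
    (h : ENNReal.ofReal c • volume.restrict A ≤
      volume.withDensity fun x => ENNReal.ofReal (f x)) :
    ENNReal.ofReal (c ^ α) * volume A ≤ renyiIntegral f α := by
  have hae : (fun _ => ENNReal.ofReal c) ≤ᵐ[volume.restrict A] fun x => ENNReal.ofReal (f x) := by
    refine ae_le_of_forall_setLIntegral_le_of_sigmaFinite measurable_const fun s hs _ => ?_
    have := h (s ∩ A)
    rw [Measure.smul_apply, Measure.restrict_apply (hs.inter hA), Set.inter_assoc, Set.inter_self,
      withDensity_apply _ (hs.inter hA)] at this
    rwa [setLIntegral_const, Measure.restrict_apply hs, Measure.restrict_restrict hs]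
  calc ENNReal.ofReal (c ^ α) * volume A = ∫⁻ _ in A, ENNReal.ofReal (c ^ α) := by
        rw [setLIntegral_const]
    _ ≤ ∫⁻ x in A, ENNReal.ofReal (f x ^ α) := by
        refine lintegral_mono_ae ?_
        filter_upwards [hae] with x hx
        rcases hc.eq_or_lt with rfl | hc
        · simp [Real.zero_rpow hα.ne']
        · have hcf : c ≤ f x := (ENNReal.ofReal_le_ofReal_iff'.1 hx).resolve_right hc.not_ge
          exact ENNReal.ofReal_le_ofReal (Real.rpow_le_rpow hc.le hcf hα.le)
    _ ≤ renyiIntegral f α := setLIntegral_le_lintegral _ _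

theorem hasDensityFamilyNat_rnDeriv {μ : Measure (ℕ → ℝ)} [IsProbabilityMeasure μ]
    (h : ∀ n, μ.map (nvec n) ≪ volume) :
    HasDensityFamilyNat μ fun n x => ((μ.map (nvec n)).rnDeriv volume x).toReal := by
  intro n
  have : IsProbabilityMeasure (μ.map (nvec n)) :=
    Measure.isProbabilityMeasure_map (measurable_nvec n).aemeasurable
  have hd : volume.withDensity
      (fun x => ENNReal.ofReal ((μ.map (nvec n)).rnDeriv volume x).toReal) = μ.map (nvec n) := by
    rw [← Measure.withDensity_rnDeriv_eq _ _ (h n)]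
    refine withDensity_congr_ae ?_
    rw [Measure.withDensity_rnDeriv_eq _ _ (h n)]
    filter_upwards [Measure.rnDeriv_lt_top (μ.map (nvec n)) volume] with x hx
    exact ENNReal.ofReal_toReal hx.ne
  refine ⟨⟨(Measure.measurable_rnDeriv _ _).ennreal_toReal, fun _ => ENNReal.toReal_nonneg, ?_⟩,
    hd.symm⟩
  rw [← setLIntegral_univ, ← withDensity_apply _ MeasurableSet.univ, hd, measure_univ]

theorem one_lt_growth {α : ℝ} {n : ℕ} (hn : 3 * α < n * (1 - α)) :
    1 < (1 / 8 / 2 ^ n : ℝ) ^ α * 2 ^ n := by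
  have e : (1 / 8 / 2 ^ n : ℝ) = 2 ^ (-3 - n : ℝ) := by
    rw [Real.rpow_sub two_pos, Real.rpow_natCast, Real.rpow_neg two_pos.le]
    norm_num
  rw [e, ← Real.rpow_mul two_pos.le, ← Real.rpow_natCast, ← Real.rpow_add two_pos]
  exact Real.one_lt_rpow one_lt_two (by linarith)

theorem IsTriangularFactor.renyiIntegral_eq_top {p : ℕ} {b : ℕ → ℝ} {v : ℕ → ℕ → ℝ} {n : ℕ}
    (hv : IsTriangularFactor p b n v) {f : (Fin n → ℝ) → ℝ} {α : ℝ} (hα : 0 < α)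
    (hn : 3 * α < n * (1 - α))
    (hf : (cubeMixture.map (causalFilter v)).map (nvec n) =
      volume.withDensity fun x => ENNReal.ofReal (f x)) :
    renyiIntegral f α = ∞ := by
  set g := Matrix.toLin' (triangularMatrix v n) with hg
  set A : ℕ → Set (Fin n → ℝ) := fun k =>
    g '' Set.univ.pi fun _ : Fin n => Set.Icc (-2 ^ k : ℝ) (2 ^ k) with hA
  set D : ℝ := |LinearMap.det g| * 2 ^ n with hD
  have hDpos : 0 < D := mul_pos (abs_pos.2 hv.det_ne_zero) (by positivity)
  have hAm : ∀ k, MeasurableSet (A k) := fun k =>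
    ((isCompact_univ_pi fun _ => isCompact_Icc).image
      g.continuous_of_finiteDimensional).measurableSet
  have hvol : ∀ k, volume (A k) = ENNReal.ofReal (D * (2 ^ n) ^ k) := fun k => by
    rw [hA, Measure.addHaar_image_linearMap, volume_pi_pi]
    simp_rw [volume_dyadicIcc]
    rw [Finset.prod_const, Finset.card_univ, Fintype.card_fin, ← ENNReal.ofReal_pow (by positivity),
      ← ENNReal.ofReal_mul (abs_nonneg _), hD]
    congr 1
    rw [mul_pow, pow_right_comm]
    ring
  have hbound : ∀ k : ℕ, ENNReal.ofReal
      ((7 / 8 / D) ^ α * D * ((1 / 8 / 2 ^ n : ℝ) ^ α * 2 ^ n) ^ k) ≤ renyiIntegral f α := by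
    intro k
    have hV : 0 < D * (2 ^ n) ^ k := by positivity
    have hc : (0 : ℝ) ≤ 7 / 8 / D * (1 / 8 / 2 ^ n) ^ k := by positivity
    have hw : mixWeight k * (D * (2 ^ n) ^ k)⁻¹ = 7 / 8 / D * (1 / 8 / 2 ^ n) ^ k := by
      rw [mixWeight, div_pow (1 / 8 : ℝ)]
      field_simp
    refine le_trans (le_of_eq ?_) (le_renyiIntegral hα hc (hAm k) ?_)
    · rw [hvol, ← ENNReal.ofReal_mul (by positivity),
        Real.mul_rpow (by positivity) (by positivity), mul_pow, ← Real.rpow_pow_comm (by positivity)]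
      congr 1
      ring
    · rw [← hf, hv.map_nvec]
      refine le_trans (le_of_eq ?_) (Measure.le_sum _ k)
      rw [ProbabilityTheory.cond, ← hg, smul_smul]
      congr 1
      change _ = ENNReal.ofReal (mixWeight k) * (volume (A k))⁻¹
      rw [hvol, ← ENNReal.ofReal_inv_of_pos hV, ← ENNReal.ofReal_mul (mixWeight_pos k).le, hw]
  refine top_le_iff.1 (le_of_tendsto' (ENNReal.tendsto_ofReal_atTop.comp
    (Tendsto.const_mul_atTop (by positivity) (tendsto_pow_atTop_atTop_of_one_lt
      (one_lt_growth hn)))) hbound)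

/-- Theorem 3, case `0 < α < 1`: if the `(p+1)×(p+1)` Toeplitz matrix
built from `α₀, …, α_p` is positive definite and `0 < α < 1`, then the supremum of the
order-`α` Rényi rate over all one-sided processes with `E[X_i X_{i+k}] = α_k`
(`i ∈ ℕ`, `0 ≤ k ≤ p`) is `+∞`: for every `M` there is such a process whose Rényi rate is
defined and exceeds `M`. -/
theorem burg_renyi_rate_alpha_lt_one
    (p : ℕ) (a : ℕ → ℝ) (hpos : (toeplitz p a).PosDef)
    (α : ℝ) (hα0 : 0 < α) (hα1 : α < 1) (M : ℝ) :
    ∃ (μ : Measure (ℕ → ℝ)) (_ : IsProbabilityMeasure μ)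
      (F : (n : ℕ) → (Fin n → ℝ) → ℝ) (L : EReal),
      SatisfiesBurgConstraints μ p a ∧
      HasDensityFamilyNat μ F ∧
      HasRenyiRate F α L ∧
      ((M : ℝ) : EReal) < L := by
  have hb : (toeplitz p fun k => 12 / 7 * a k).PosDef :=
    hpos.smul (show (0 : ℝ) < 12 / 7 by norm_num)
  obtain ⟨v, hv⟩ := exists_triangularFactor hb
  have hprob : IsProbabilityMeasure (cubeMixture.map (causalFilter v)) :=
    Measure.isProbabilityMeasure_map (measurable_causalFilter v).aemeasurable
  have hdens := hasDensityFamilyNat_rnDeriv (μ := cubeMixture.map (causalFilter v)) fun n => by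
    rw [(hv n).map_nvec]
    exact Measure.absolutelyContinuous_sum_left fun k =>
      Measure.AbsolutelyContinuous.smul_left ProbabilityTheory.cond_absolutelyContinuous _
  refine ⟨_, hprob, _, ⊤, satisfiesBurgConstraints_causalFilter hv fun k => by ring, hdens, ?_,
    EReal.coe_lt_top M⟩
  refine tendsto_const_nhds.congr' ?_
  filter_upwards [eventually_gt_atTop 0,
    (tendsto_natCast_atTop_atTop.atTop_mul_const (sub_pos.2 hα1)).eventually_gt_atTop (3 * α)]
    with n hn0 hn
  rw [renyiEntropy, if_pos ((hv n).renyiIntegral_eq_top hα0 hn (hdens n).2), if_pos hα1,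
    EReal.coe_mul_top_of_pos (by positivity)]
end
end
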